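/- arXiv:0812.1374 — 3 statements merged into one kernel-verified Lean document; each statement's English description precedes it below -/
import Mathlib

section
/- For a non-principal Dirichlet character χ mod q and arbitrary X > 0, L(1,χ) = ∑_{n ≤ X} χ(n)/n + ∑_{a=1}^q χ(a)·[ ψ((X-a)/q)/X - (1/q)∫_{X/q}^∞ ψ(u - a/q)/u² du ], where ψ(u) = u - ⌊u⌋ - 1/2. -/
open Complex MeasureTheory

/-- The sawtooth function `ψ(u) = u - ⌊u⌋ - 1/2`. -/
noncomputable def saw (u : ℝ) : ℝ := u - ⌊u⌋ - 1/2

open Filter Topology Set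

/-- The number of positive integers up to `x` congruent to `a` modulo `q`, for `1 ≤ a ≤ q`. -/
lemma card_Icc_filter_modEq {q : ℕ} {a : ℕ} (ha : a ∈ Finset.Icc 1 q) {x : ℝ}
    (hx : 0 ≤ x) :
    ((Finset.Icc 1 ⌊x⌋₊).filter (fun n => n ≡ a [MOD q])).card =
      ⌊(x - a) / q⌋ + 1 := by
  obtain ⟨ha1, haq⟩ := Finset.mem_Icc.mp ha
  have hq0 : 0 < q := by omega
  have key := Nat.Ioc_filter_modEq_card 0 ⌊x⌋₊ hq0 a
  have h0 : ⌊((0 : ℕ) - (a : ℚ)) / (q : ℚ)⌋ = -1 := by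
    have h1 : (1 : ℚ) ≤ a := by exact_mod_cast ha1
    have h2 : (a : ℚ) ≤ q := by exact_mod_cast haq
    have h3 : (0 : ℚ) < q := by exact_mod_cast hq0
    rw [Int.floor_eq_iff]
    constructor
    · rw [le_div_iff₀ h3]; push_cast; linarith
    · rw [div_lt_iff₀ h3]; push_cast; linarith
  have h1 : ⌊((⌊x⌋₊ : ℚ) - (a : ℚ)) / (q : ℚ)⌋ = ⌊(x - a) / q⌋ := by
    rw [Int.floor_div_natCast, Int.floor_div_natCast, Int.floor_sub_natCast,
      Int.floor_sub_natCast, Int.floor_natCast, Int.natCast_floor_eq_floor hx]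
  have h2 : (-1 : ℤ) ≤ ⌊(x - a) / q⌋ := by
    have h2 : (a : ℝ) ≤ q := by exact_mod_cast haq
    have h3 : (0 : ℝ) < q := by exact_mod_cast hq0
    rw [Int.le_floor, le_div_iff₀ h3]; push_cast; linarith
  rw [h0, h1, max_eq_left (by linarith)] at key
  rw [show Finset.Icc 1 ⌊x⌋₊ = Finset.Ioc 0 ⌊x⌋₊ from rfl, key]
  ring

lemma sum_Icc_eq_sum_zmod {q : ℕ} [NeZero q] (g : ZMod q → ℂ) :
    ∑ a ∈ Finset.Icc 1 q, g a = ∑ a : ZMod q, g a := by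
  refine Finset.sum_bij (fun a _ => (a : ZMod q)) (fun _ _ => Finset.mem_univ _) ?_ ?_
    (fun _ _ => rfl)
  · intro a ha b hb hab
    rw [Finset.mem_Icc] at ha hb
    rw [ZMod.natCast_eq_natCast_iff] at hab
    rcases le_total a b with h | h
    · have := (Nat.modEq_iff_dvd' h).mp hab
      by_contra hne
      have := Nat.le_of_dvd (by omega) this
      omega
    · have := (Nat.modEq_iff_dvd' h).mp hab.symm
      by_contra hne
      have := Nat.le_of_dvd (by omega) this
      omega
  · intro b _
    have hq := NeZero.pos q
    by_cases hb : b = 0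
    · exact ⟨q, by simp; omega, by simp [hb]⟩
    · have : b.val ≠ 0 := by rwa [ne_eq, ZMod.val_eq_zero]
      exact ⟨b.val, Finset.mem_Icc.mpr ⟨by omega, b.val_lt.le⟩, by simp⟩

/-- Partial sums of a non-principal character in terms of the sawtooth function. -/
lemma sum_char_eq_saw {q : ℕ} [NeZero q] {χ : DirichletCharacter ℂ q} (hχ : χ ≠ 1)
    {x : ℝ} (hx : 0 ≤ x) :
    ∑ n ∈ Finset.Icc 1 ⌊x⌋₊, χ (n : ZMod q) =
      -∑ a ∈ Finset.Icc 1 q, χ (a : ZMod q) * ((saw ((x - a) / q) : ℝ) + (a : ℂ) / q) := by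
  have hsum : ∑ a ∈ Finset.Icc 1 q, χ (a : ZMod q) = 0 :=
    (sum_Icc_eq_sum_zmod χ).trans (χ.sum_eq_zero_of_ne_one hχ)
  have h1 : ∀ n : ℕ, χ (n : ZMod q) =
      ∑ a ∈ Finset.Icc 1 q, if n ≡ a [MOD q] then χ (a : ZMod q) else 0 := by
    intro n
    simp_rw [← ZMod.natCast_eq_natCast_iff]
    rw [sum_Icc_eq_sum_zmod (fun a => if (n : ZMod q) = a then χ a else 0),
      Finset.sum_ite_eq, if_pos (Finset.mem_univ _)]
  have h2 : ∑ n ∈ Finset.Icc 1 ⌊x⌋₊, χ (n : ZMod q) =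
      ∑ a ∈ Finset.Icc 1 q, χ (a : ZMod q) * ((⌊(x - a) / q⌋ : ℂ) + 1) := by
    rw [Finset.sum_congr rfl fun n _ => h1 n, Finset.sum_comm]
    refine Finset.sum_congr rfl fun a ha => ?_
    rw [← Finset.sum_filter, Finset.sum_const, nsmul_eq_mul, mul_comm]
    congr 1
    exact_mod_cast congrArg (Int.cast : ℤ → ℂ) (card_Icc_filter_modEq ha hx)
  have h3 : ∀ a : ℕ, χ (a : ZMod q) * ((⌊(x - a) / q⌋ : ℂ) + 1) =
      χ (a : ZMod q) * ((x : ℂ) / q + 1 / 2) -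
        χ (a : ZMod q) * ((saw ((x - a) / q) : ℝ) + (a : ℂ) / q) := by
    intro a
    rw [← mul_sub]
    congr 1
    simp only [saw]
    push_cast
    ring
  rw [h2, Finset.sum_congr rfl fun a _ => h3 a, Finset.sum_sub_distrib, ← Finset.sum_mul, hsum]
  simp

lemma abs_saw_le (u : ℝ) : |saw u| ≤ 1 / 2 := by
  have h1 := Int.floor_le u
  have h2 := Int.lt_floor_add_one u
  rw [abs_le, saw]
  constructor <;> linarith

lemma measurable_saw : Measurable saw := by
  unfold saw
  fun_prop

lemma norm_sum_char_le {q : ℕ} [NeZero q] {χ : DirichletCharacter ℂ q} (hχ : χ ≠ 1) (n : ℕ) :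
    ‖∑ k ∈ Finset.Icc 1 n, χ (k : ZMod q)‖ ≤ 2 * q := by
  have h := sum_char_eq_saw hχ (Nat.cast_nonneg (α := ℝ) n)
  rw [Nat.floor_natCast] at h
  rw [h, norm_neg]
  have hq : (0 : ℝ) < q := by exact_mod_cast NeZero.pos q
  calc _ ≤ ∑ a ∈ Finset.Icc 1 q, (2 : ℝ) := by
        refine norm_sum_le_of_le _ fun a ha => ?_
        rw [norm_mul]
        have h1 : ‖χ (a : ZMod q)‖ ≤ 1 := χ.norm_le_one _
        have h2 : ‖((saw (((n : ℝ) - a) / q) : ℝ) : ℂ)‖ ≤ 1 / 2 := by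
          rw [Complex.norm_real]; exact abs_saw_le _
        have h3 : ‖(a : ℂ) / q‖ ≤ 1 := by
          rw [norm_div, Complex.norm_natCast, Complex.norm_natCast, div_le_one hq]
          exact_mod_cast (Finset.mem_Icc.mp ha).2
        calc _ ≤ 1 * ‖((saw (((n : ℝ) - a) / q) : ℝ) : ℂ) + (a : ℂ) / q‖ := by gcongr
          _ ≤ 2 := by
            have := norm_add_le ((saw (((n : ℝ) - a) / q) : ℝ) : ℂ) ((a : ℂ) / q)
            linarith
    _ = 2 * q := by simp [mul_comm]

lemma integrableOn_Ioi_div_sq {X : ℝ} (hX : 0 < X) {g : ℝ → ℂ} (hg : Measurable g) {C : ℝ}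
    (hC : ∀ t, ‖g t‖ ≤ C) : IntegrableOn (fun t : ℝ => g t / (t : ℂ) ^ 2) (Ioi X) := by
  have hb : IntegrableOn (fun t : ℝ => C * t ^ (-2 : ℝ)) (Ioi X) :=
    (integrableOn_Ioi_rpow_of_lt (by norm_num) hX).const_mul C
  refine hb.mono' (hg.div (by fun_prop)).aestronglyMeasurable ?_
  filter_upwards [ae_restrict_mem measurableSet_Ioi] with t ht
  have ht0 : 0 < t := hX.trans ht
  rw [norm_div, norm_pow, Complex.norm_real, Real.norm_of_nonneg ht0.le, Real.rpow_neg ht0.le,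
    div_eq_mul_inv]
  norm_cast
  gcongr
  exact hC t

lemma measurable_sum_floor (f : ℕ → ℂ) :
    Measurable fun t : ℝ => ∑ k ∈ Finset.Icc 1 ⌊t⌋₊, f k :=
  (measurable_from_nat (f := fun n => ∑ k ∈ Finset.Icc 1 n, f k)).comp Nat.measurable_floor

lemma LFunction_one_eq_integral {q : ℕ} [NeZero q] {χ : DirichletCharacter ℂ q} (hχ : χ ≠ 1) :
    DirichletCharacter.LFunction χ 1 =
      ∫ t in Ioi (1 : ℝ), (∑ k ∈ Finset.Icc 1 ⌊t⌋₊, χ (k : ZMod q)) / (t : ℂ) ^ 2 := by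
  set S : ℝ → ℂ := fun t => ∑ k ∈ Finset.Icc 1 ⌊t⌋₊, χ (k : ZMod q) with hS
  have hSm : Measurable S := measurable_sum_floor _
  have hSb : ∀ t, ‖S t‖ ≤ 2 * q := fun t => norm_sum_char_le hχ _
  have hL : ∀ s : ℝ, 1 < s → DirichletCharacter.LFunction χ s =
      s * ∫ t in Ioi (1 : ℝ), S t * (t : ℂ) ^ (-((s : ℂ) + 1)) := by
    intro s hs
    have hs' : 1 < (s : ℂ).re := by simpa using hs
    rw [DirichletCharacter.LFunction_eq_LSeries χ hs']
    refine LSeries_eq_mul_integral _ le_rfl (by simp; linarith)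
      (DirichletCharacter.LSeriesSummable_of_one_lt_re χ hs') ?_
    refine Asymptotics.IsBigO.of_bound (2 * q) (Eventually.of_forall fun n => ?_)
    simpa using norm_sum_char_le hχ n
  have hlim1 : Tendsto (fun s : ℝ => DirichletCharacter.LFunction χ s) (𝓝[>] 1)
      (𝓝 (DirichletCharacter.LFunction χ 1)) := by
    have hc : Continuous fun s : ℝ => DirichletCharacter.LFunction χ s :=
      (DirichletCharacter.differentiable_LFunction hχ).continuous.comp continuous_ofReal
    simpa using (hc.tendsto 1).mono_left nhdsWithin_le_nhds
  have hlim2 : Tendsto (fun s : ℝ => ∫ t in Ioi (1 : ℝ), S t * (t : ℂ) ^ (-((s : ℂ) + 1)))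
      (𝓝[>] 1) (𝓝 (∫ t in Ioi (1 : ℝ), S t / (t : ℂ) ^ 2)) := by
    refine tendsto_integral_filter_of_dominated_convergence
      (fun t : ℝ => 2 * q * t ^ (-2 : ℝ)) ?_ ?_ ?_ ?_
    · exact Eventually.of_forall fun s => by fun_prop
    · filter_upwards [self_mem_nhdsWithin] with s hs
      filter_upwards [ae_restrict_mem measurableSet_Ioi] with t ht
      have hs' : (1 : ℝ) < s := hs
      have ht' : (1 : ℝ) < t := ht
      rw [norm_mul, Complex.norm_cpow_eq_rpow_re_of_pos (by linarith)]
      gcongr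
      · exact hSb t
      · exact ht'.le
      · simp; linarith
    · exact (integrableOn_Ioi_rpow_of_lt (by norm_num) one_pos).const_mul _
    · filter_upwards [ae_restrict_mem measurableSet_Ioi] with t ht
      have ht0 : (t : ℂ) ≠ 0 := by
        have : (0 : ℝ) < t := one_pos.trans ht
        exact_mod_cast this.ne'
      have hc : Continuous fun s : ℝ => S t * (t : ℂ) ^ (-((s : ℂ) + 1)) := by
        refine continuous_const.mul (Continuous.const_cpow (by fun_prop) (Or.inl ht0))
      have := (hc.tendsto 1).mono_left (nhdsWithin_le_nhds (s := Ioi 1))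
      convert this using 2
      rw [div_eq_mul_inv, Complex.cpow_neg]
      norm_num
  have hid : Tendsto (fun s : ℝ => (s : ℂ)) (𝓝[>] 1) (𝓝 1) := by
    simpa using (continuous_ofReal.tendsto 1).mono_left (nhdsWithin_le_nhds (s := Ioi 1))
  refine tendsto_nhds_unique hlim1 ?_
  have := hid.mul hlim2
  rw [one_mul] at this
  refine this.congr' ?_
  filter_upwards [self_mem_nhdsWithin] with s hs using (hL s hs).symm

lemma LFunction_one_eq_sum_add_integral {q : ℕ} [NeZero q] {χ : DirichletCharacter ℂ q}
    (hχ : χ ≠ 1) {X : ℝ} (hX : 0 < X) :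
    DirichletCharacter.LFunction χ 1 =
      ∑ n ∈ Finset.Icc 1 ⌊X⌋₊, χ (n : ZMod q) / (n : ℂ)
      - (∑ n ∈ Finset.Icc 1 ⌊X⌋₊, χ (n : ZMod q)) / X
      + ∫ t in Ioi X, (∑ k ∈ Finset.Icc 1 ⌊t⌋₊, χ (k : ZMod q)) / (t : ℂ) ^ 2 := by
  rw [LFunction_one_eq_integral hχ]
  have hint : ∀ {Y : ℝ}, 0 < Y → IntegrableOn
      (fun t : ℝ => (∑ k ∈ Finset.Icc 1 ⌊t⌋₊, χ (k : ZMod q)) / (t : ℂ) ^ 2) (Ioi Y) :=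
    fun hY => integrableOn_Ioi_div_sq hY (measurable_sum_floor _) fun t => norm_sum_char_le hχ _
  rcases lt_or_ge X 1 with h1 | h1
  · have hz : ∫ t in Ioc X 1, (∑ k ∈ Finset.Icc 1 ⌊t⌋₊, χ (k : ZMod q)) / (t : ℂ) ^ 2 = 0 := by
      rw [integral_Ioc_eq_integral_Ioo]
      refine setIntegral_eq_zero_of_forall_eq_zero fun t ht => ?_
      simp [Nat.floor_eq_zero.mpr ht.2]
    have hu := setIntegral_union (Ioc_disjoint_Ioi le_rfl) measurableSet_Ioi
      ((hint hX).mono_set Ioc_subset_Ioi_self) (hint one_pos)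
    rw [Ioc_union_Ioi_eq_Ioi h1.le, hz, zero_add] at hu
    rw [hu]
    simp [Nat.floor_eq_zero.mpr h1]
  · have hu := setIntegral_union (Ioc_disjoint_Ioi le_rfl) measurableSet_Ioi
      ((hint one_pos).mono_set Ioc_subset_Ioi_self) (hint hX)
    rw [Ioc_union_Ioi_eq_Ioi h1] at hu
    rw [hu]
    set c : ℕ → ℂ := fun n => if n = 0 then 0 else χ (n : ZMod q) with hc
    have hd : ∀ t : ℝ, t ≠ 0 → HasDerivAt (fun t : ℝ => (t : ℂ)⁻¹) (-((t : ℂ) ^ 2)⁻¹) t :=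
      fun t ht => (hasDerivAt_inv (by exact_mod_cast ht)).comp_ofReal
    have hcs : ∀ n : ℕ, ∀ w : ℕ → ℂ, ∑ k ∈ Finset.Icc 0 n, w k * c k =
        ∑ k ∈ Finset.Icc 1 n, w k * χ (k : ZMod q) := by
      intro n w
      rw [Finset.Icc_eq_cons_Ioc (Nat.zero_le _), Finset.sum_cons]
      simp only [hc, if_true, mul_zero, zero_add]
      refine Finset.sum_congr rfl fun k hk => ?_
      rw [if_neg (by have := (Finset.mem_Ioc.mp hk).1; omega)]
    have hcs' : ∀ n : ℕ, ∑ k ∈ Finset.Icc 0 n, c k =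
        ∑ k ∈ Finset.Icc 1 n, χ (k : ZMod q) := by
      intro n
      simpa using hcs n 1
    have hA := sum_mul_eq_sub_integral_mul₀ (f := fun t : ℝ => (t : ℂ)⁻¹) c (by simp [hc]) X
      (fun t ht => (hd t (by linarith [ht.1])).differentiableAt) (by
        have : EqOn (fun t : ℝ => -((t : ℂ) ^ 2)⁻¹) (deriv fun t : ℝ => (t : ℂ)⁻¹) (Icc 1 X) :=
          fun t ht => (hd t (by linarith [ht.1])).deriv.symm
        refine IntegrableOn.congr_fun (ContinuousOn.integrableOn_Icc ?_) this measurableSet_Icc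
        refine ContinuousOn.neg (ContinuousOn.inv₀ (by fun_prop) fun t ht => ?_)
        have : t ≠ 0 := by linarith [ht.1]
        exact_mod_cast pow_ne_zero 2 this)
    rw [hcs ⌊X⌋₊ (fun k => ((k : ℝ) : ℂ)⁻¹)] at hA
    simp_rw [hcs'] at hA
    have hI : ∫ t in Ioc 1 X, deriv (fun t : ℝ => (t : ℂ)⁻¹) t *
          ∑ k ∈ Finset.Icc 1 ⌊t⌋₊, χ (k : ZMod q) =
        -∫ t in Ioc 1 X, (∑ k ∈ Finset.Icc 1 ⌊t⌋₊, χ (k : ZMod q)) / (t : ℂ) ^ 2 := by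
      rw [← integral_neg]
      refine setIntegral_congr_fun measurableSet_Ioc fun t ht => ?_
      rw [(hd t (by linarith [ht.1])).deriv]
      ring
    rw [hI] at hA
    have hB : ∑ n ∈ Finset.Icc 1 ⌊X⌋₊, χ (n : ZMod q) / (n : ℂ) =
        ∑ n ∈ Finset.Icc 1 ⌊X⌋₊, ((n : ℝ) : ℂ)⁻¹ * χ (n : ZMod q) :=
      Finset.sum_congr rfl fun n _ => by push_cast; ring
    rw [hB, hA]
    ring

lemma integral_saw_rescale {q : ℕ} [NeZero q] (a : ℕ) (X : ℝ) :
    ∫ t in Ioi X, saw ((t - a) / q) / t ^ 2 =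
      (1 / q : ℝ) * ∫ u in Ioi (X / q), saw (u - a / q) / u ^ 2 := by
  have hq : (0 : ℝ) < q := by exact_mod_cast NeZero.pos q
  have h := integral_comp_mul_left_Ioi' (fun t : ℝ => saw ((t - a) / q) / t ^ 2) (X / q) hq
  rw [mul_div_cancel₀ _ hq.ne'] at h
  rw [← h, smul_eq_mul, ← integral_const_mul, ← integral_const_mul]
  congr 1
  ext u
  rw [sub_div, mul_div_cancel_left₀ _ hq.ne']
  field_simp

lemma integral_Ioi_inv_sq {X : ℝ} (hX : 0 < X) : ∫ t in Ioi X, (1 : ℂ) / (t : ℂ) ^ 2 = 1 / X := by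
  have h := integral_Ioi_rpow_of_lt (a := -2) (by norm_num) hX
  have h2 : ∫ t in Ioi X, 1 / t ^ 2 = 1 / X := by
    rw [setIntegral_congr_fun (g := fun t : ℝ => t ^ (-2 : ℝ)) measurableSet_Ioi, h]
    · norm_num [Real.rpow_neg_one]
    · intro t ht
      simp only
      rw [Real.rpow_neg (hX.trans ht).le]
      norm_num
  have h3 := integral_ofReal (𝕜 := ℂ) (μ := volume.restrict (Ioi X)) (f := fun t : ℝ => 1 / t ^ 2)
  rw [h2] at h3
  simpa using h3

/-- For a non-principal Dirichlet character `χ` mod `q` and `X > 0`,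
`L(1,χ) = ∑_{n ≤ X} χ(n)/n + ∑_{a=1}^q χ(a)·[ψ((X-a)/q)/X - (1/q)∫_{X/q}^∞ ψ(u-a/q)/u² du]`. -/
theorem stmt4 (q : ℕ) [NeZero q] (hq : 1 ≤ q) (χ : DirichletCharacter ℂ q) (hχ : χ ≠ 1)
    (X : ℝ) (hX : 0 < X) :
    DirichletCharacter.LFunction χ 1 =
      (∑ n ∈ Finset.Icc 1 ⌊X⌋₊, χ (n : ZMod q) / (n : ℂ))
      + ∑ a ∈ Finset.Icc 1 q, χ (a : ZMod q) *
          ((saw ((X - a) / q) / X : ℝ)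
            - (1 / q : ℝ) * ∫ u in Set.Ioi (X / q), saw (u - a / q) / u ^ 2 : ℝ) := by
  have hsaw : ∀ a : ℕ, IntegrableOn
      (fun t : ℝ => ((saw ((t - a) / q) : ℝ) : ℂ) / (t : ℂ) ^ 2) (Ioi X) := by
    intro a
    refine integrableOn_Ioi_div_sq hX (C := 1 / 2)
      (measurable_ofReal.comp (measurable_saw.comp (by fun_prop))) fun t => ?_
    rw [Complex.norm_real]
    exact abs_saw_le _
  have hone : IntegrableOn (fun t : ℝ => (1 : ℂ) / (t : ℂ) ^ 2) (Ioi X) :=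
    integrableOn_Ioi_div_sq hX measurable_const (C := 1) (by simp)
  have hI : ∫ t in Ioi X, (∑ k ∈ Finset.Icc 1 ⌊t⌋₊, χ (k : ZMod q)) / (t : ℂ) ^ 2 =
      -∑ a ∈ Finset.Icc 1 q, χ (a : ZMod q) *
        (((∫ t in Ioi X, saw ((t - a) / q) / t ^ 2 : ℝ) : ℂ) + (a : ℂ) / q * (1 / X)) := by
    rw [setIntegral_congr_fun (g := fun t : ℝ => -∑ a ∈ Finset.Icc 1 q, χ (a : ZMod q) *
      (((saw ((t - a) / q) : ℝ) : ℂ) / (t : ℂ) ^ 2 + (a : ℂ) / q * (1 / (t : ℂ) ^ 2)))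
      measurableSet_Ioi]
    · rw [integral_neg, integral_finsetSum]
      · congr 1
        refine Finset.sum_congr rfl fun a _ => ?_
        rw [integral_const_mul, integral_add (hsaw a) (hone.const_mul _), integral_const_mul,
          integral_Ioi_inv_sq hX, ← integral_complex_ofReal]
        simp
      · exact fun a _ => ((hsaw a).add (hone.const_mul _)).const_mul _
    · intro t ht
      simp only
      rw [sum_char_eq_saw hχ (hX.trans ht).le, neg_div, Finset.sum_div]
      congr 1
      exact Finset.sum_congr rfl fun a _ => by ring
  rw [LFunction_one_eq_sum_add_integral hχ hX, hI, sum_char_eq_saw hχ hX.le, sub_add,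
    sub_eq_add_neg]
  congr 1
  rw [neg_div, Finset.sum_div, sub_neg_eq_add, neg_add_eq_sub, neg_sub, ← Finset.sum_sub_distrib]
  refine Finset.sum_congr rfl fun a _ => ?_
  rw [integral_saw_rescale]
  push_cast
  ring
end

section
/- Let γ_r(α) be the Laurent coefficients of the Hurwitz zeta function at s = 1, i.e. ζ(s,α) = 1/(s-1) + ∑_{r≥0} γ_r(α)(s-1)^r. Then for every integer r ≥ 1 and 0 < α ≤ 1, | γ_r(α) - (-1)^r (log α)^r/(r!·α) | ≤ e · (1/r!) · (r/(2e))^r. -/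
open Complex Filter Topology Real

/-- The third Bernoulli polynomial `x ^ 3 - 3 / 2 * x ^ 2 + x / 2`. -/
noncomputable def bernoulliCubic (x : ℝ) : ℝ := x * (x - 1 / 2) * (x - 1)

lemma abs_bernoulliCubic_le {x : ℝ} (h0 : 0 ≤ x) (h1 : x ≤ 1) : |bernoulliCubic x| ≤ 1 / 20 := by
  unfold bernoulliCubic
  rw [abs_le]
  constructor
  · nlinarith [mul_nonneg h0 (sq_nonneg (x - 1 / 2 - 29 / 100)), sq_nonneg (x - 1 / 2 - 29 / 100)]
  · nlinarith [mul_nonneg (sub_nonneg.2 h1) (sq_nonneg (x - 1 / 2 + 29 / 100)),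
      sq_nonneg (x - 1 / 2 + 29 / 100)]

lemma hasDerivAt_cpow_primitive {s : ℂ} (hs : 1 < s.re) {c t : ℝ} (ht : 0 < t) :
    HasDerivAt (fun t : ℝ =>
      (bernoulliCubic (t - c) : ℂ) / 6 * (s * (s + 1)) * (t : ℂ) ^ (-s - 2)
        + (((t - c) ^ 2 - (t - c) + 1 / 6 : ℝ) : ℂ) / 2 * s * (t : ℂ) ^ (-s - 1)
        + ((t - c - 1 / 2 : ℝ) : ℂ) * (t : ℂ) ^ (-s) - (t : ℂ) ^ (1 - s) / (1 - s))
      (-(s * (s + 1) * (s + 2)) / 6 * ((t : ℂ) ^ (-s - 3) * (bernoulliCubic (t - c) : ℂ))) t := by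
  have hne (z : ℂ) (h : z.re < 0) : z ≠ 0 := by rintro rfl; simp at h
  have p (z : ℂ) (h : z.re < 0) : HasDerivAt (fun y : ℝ => (y : ℂ) ^ z) (z * t ^ (z - 1)) t :=
    hasDerivAt_ofReal_cpow_const ht.ne' (hne z h)
  have b3 : HasDerivAt (fun t : ℝ => (bernoulliCubic (t - c) : ℂ))
      ((3 * ((t - c) ^ 2 - (t - c) + 1 / 6) : ℝ) : ℂ) t := by
    apply HasDerivAt.ofReal_comp
    unfold bernoulliCubic
    have h := (hasDerivAt_id t).sub_const c
    convert! (h.mul (h.sub_const (1 / 2))).mul (h.sub_const 1) using 1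
    simp; ring
  have b2 : HasDerivAt (fun t : ℝ => (((t - c) ^ 2 - (t - c) + 1 / 6 : ℝ) : ℂ))
      ((2 * (t - c - 1 / 2) : ℝ) : ℂ) t := by
    apply HasDerivAt.ofReal_comp
    have h := (hasDerivAt_id t).sub_const c
    convert! ((h.pow 2).sub h).add_const (1 / 6) using 1
    simp; ring
  have b1 : HasDerivAt (fun t : ℝ => ((t - c - 1 / 2 : ℝ) : ℂ)) ((1 : ℝ) : ℂ) t := by
    apply HasDerivAt.ofReal_comp
    exact ((hasDerivAt_id t).sub_const c).sub_const _
  have h1s : (1 - s) ≠ 0 := hne _ (by simpa using hs)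
  have h := ((((b3.div_const 6).mul_const (s * (s + 1))).mul (p (-s - 2) (by simp; linarith))).add
    (((b2.div_const 2).mul_const s).mul (p (-s - 1) (by simp; linarith)))).add
    (b1.mul (p (-s) (by simp; linarith))) |>.sub
    ((p (1 - s) (by simp; linarith)).div_const (1 - s))
  convert! h using 1
  rw [show -s - 2 - 1 = -s - 3 by ring, show -s - 1 - 1 = -s - 2 by ring,
    show 1 - s - 1 = -s by ring, mul_div_cancel_left₀ _ h1s]
  push_cast
  ring

lemma continuous_bernoulliCubic : Continuous bernoulliCubic := by
  unfold bernoulliCubic; fun_prop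

lemma integral_bernoulliCubic_cpow {s : ℂ} (hs : 1 < s.re) {c : ℝ} (hc : 0 < c) :
    -(s * (s + 1) * (s + 2)) / 6 *
        ∫ t in c..c + 1, (t : ℂ) ^ (-s - 3) * (bernoulliCubic (t - c) : ℂ) =
      ((c : ℂ) ^ (-s) + (c + 1 : ℂ) ^ (-s)) / 2
        + s / 12 * ((c + 1 : ℂ) ^ (-s - 1) - (c : ℂ) ^ (-s - 1))
        - ((c + 1 : ℂ) ^ (1 - s) - (c : ℂ) ^ (1 - s)) / (1 - s) := by
  rw [← intervalIntegral.integral_const_mul]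
  have hpos : ∀ t ∈ Set.uIcc c (c + 1), 0 < t := fun t ht => by
    rw [Set.uIcc_of_le (by linarith)] at ht; linarith [ht.1]
  rw [intervalIntegral.integral_eq_sub_of_hasDerivAt
    (fun t ht => hasDerivAt_cpow_primitive hs (c := c) (hpos t ht))]
  · simp [bernoulliCubic]
    ring
  · apply ContinuousOn.intervalIntegrable
    refine continuousOn_const.mul (ContinuousOn.mul (fun t ht => ?_) ?_)
    · exact (continuousAt_ofReal_cpow_const _ _ (Or.inr (hpos t ht).ne')).continuousWithinAt
    · have := continuous_bernoulliCubic
      fun_prop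

/-- The `1`-periodic extension of the third Bernoulli polynomial based at `a`, cut off to `(a, ∞)`. -/
noncomputable def bernoulliKernel (a : ℝ) : ℝ → ℂ :=
  (Set.Ioi a).indicator fun t => (bernoulliCubic (Int.fract (t - a)) : ℂ)

lemma norm_bernoulliKernel_le (a t : ℝ) : ‖bernoulliKernel a t‖ ≤ 1 / 20 := by
  unfold bernoulliKernel
  by_cases h : t ∈ Set.Ioi a
  · rw [Set.indicator_of_mem h, Complex.norm_real]
    exact abs_bernoulliCubic_le (Int.fract_nonneg _) (Int.fract_lt_one _).le
  · rw [Set.indicator_of_notMem h]; norm_num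

lemma measurable_bernoulliKernel (a : ℝ) : Measurable (bernoulliKernel a) := by
  unfold bernoulliKernel
  refine Measurable.indicator ?_ measurableSet_Ioi
  have := continuous_bernoulliCubic.measurable
  fun_prop

lemma locallyIntegrable_bernoulliKernel (a : ℝ) :
    MeasureTheory.LocallyIntegrable (bernoulliKernel a) := by
  refine (MeasureTheory.locallyIntegrable_const (1 / 20 : ℝ)).mono
    (measurable_bernoulliKernel a).aestronglyMeasurable (MeasureTheory.ae_of_all _ fun t => ?_)
  rw [Real.norm_of_nonneg (by norm_num)]
  exact norm_bernoulliKernel_le a t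

lemma bernoulliKernel_isBigO_atTop (a : ℝ) :
    bernoulliKernel a =O[atTop] (fun t : ℝ => t ^ (-(0 : ℝ))) := by
  refine Asymptotics.IsBigO.of_bound (1 / 20) (Eventually.of_forall fun t => ?_)
  simpa using norm_bernoulliKernel_le a t

lemma bernoulliKernel_isBigO_zero {a : ℝ} (ha : 0 < a) (b : ℝ) :
    bernoulliKernel a =O[𝓝[>] 0] (fun t : ℝ => t ^ (-b)) := by
  refine Asymptotics.IsBigO.of_bound 1 ?_
  filter_upwards [mem_nhdsWithin_of_mem_nhds (Iio_mem_nhds ha)] with t ht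
  rw [bernoulliKernel, Set.indicator_of_notMem (by simpa using (le_of_lt ht)), norm_zero]
  positivity

lemma differentiableAt_mellin_bernoulliKernel {a : ℝ} (ha : 0 < a) {z : ℂ} (hz : z.re < 0) :
    DifferentiableAt ℂ (mellin (bernoulliKernel a)) z :=
  mellin_differentiableAt_of_isBigO_rpow ((locallyIntegrable_bernoulliKernel a).locallyIntegrableOn _)
    (bernoulliKernel_isBigO_atTop a) hz (bernoulliKernel_isBigO_zero ha (z.re - 1)) (by linarith)

lemma mellin_bernoulliKernel_eq {a : ℝ} (ha : 0 < a) (z : ℂ) :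
    mellin (bernoulliKernel a) z =
      ∫ t in Set.Ioi a, (t : ℂ) ^ (z - 1) * (bernoulliCubic (Int.fract (t - a)) : ℂ) := by
  have h : (fun t : ℝ => (t : ℂ) ^ (z - 1) • bernoulliKernel a t) = (Set.Ioi a).indicator
      fun t : ℝ => (t : ℂ) ^ (z - 1) * (bernoulliCubic (Int.fract (t - a)) : ℂ) := by
    ext t
    by_cases h : t ∈ Set.Ioi a <;> simp [bernoulliKernel, h]
  rw [mellin, h, MeasureTheory.setIntegral_indicator measurableSet_Ioi,
    Set.inter_eq_self_of_subset_right (Set.Ioi_subset_Ioi ha.le)]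

lemma integrableOn_cpow_mul_bernoulliCubic {a : ℝ} (ha : 0 < a) {z : ℂ} (hz : z.re < 0) :
    MeasureTheory.IntegrableOn
      (fun t : ℝ => (t : ℂ) ^ (z - 1) * (bernoulliCubic (Int.fract (t - a)) : ℂ)) (Set.Ioi a) := by
  have h : MellinConvergent (bernoulliKernel a) z :=
    mellinConvergent_of_isBigO_rpow
      ((locallyIntegrable_bernoulliKernel a).locallyIntegrableOn _)
      (bernoulliKernel_isBigO_atTop a) hz (bernoulliKernel_isBigO_zero ha (z.re - 1)) (by linarith)
  refine (h.mono_set (Set.Ioi_subset_Ioi ha.le)).congr_fun (fun t ht => ?_) measurableSet_Ioi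
  simp only [bernoulliKernel, Set.indicator_of_mem ht, smul_eq_mul]

lemma norm_mellin_bernoulliKernel_le {a : ℝ} (ha : 1 ≤ a) {z : ℂ} (hz : z.re < 0) :
    ‖mellin (bernoulliKernel a) z‖ ≤ 1 / 20 / (-z.re) := by
  have ha0 : 0 < a := by linarith
  rw [mellin_bernoulliKernel_eq ha0]
  have hint := integrableOn_Ioi_rpow_of_lt (show z.re - 1 < -1 by linarith) ha0
  calc _ ≤ ∫ t in Set.Ioi a, t ^ (z.re - 1) * (1 / 20) := by
        refine MeasureTheory.norm_integral_le_of_norm_le (hint.mul_const _) ?_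
        refine (MeasureTheory.ae_restrict_mem measurableSet_Ioi).mono fun t ht => ?_
        have ht0 : 0 < t := ha0.trans ht
        rw [norm_mul, Complex.norm_cpow_eq_rpow_re_of_pos ht0, Complex.norm_real, Real.norm_eq_abs]
        simp only [sub_re, one_re]
        gcongr
        exact abs_bernoulliCubic_le (Int.fract_nonneg _) (Int.fract_lt_one _).le
    _ = a ^ z.re * (1 / 20 / (-z.re)) := by
        rw [MeasureTheory.integral_mul_const, integral_Ioi_rpow_of_lt (by linarith) ha0]
        simp only [sub_add_cancel]
        field_simp
    _ ≤ 1 * (1 / 20 / (-z.re)) := by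
        gcongr
        · have : 0 < -z.re := by linarith
          positivity
        · exact Real.rpow_le_one_of_one_le_of_nonpos ha hz.le
    _ = _ := one_mul _

/-- The remainder of the Euler-Maclaurin formula of order three for `∑ (n + a) ^ (-s)`. -/
noncomputable def hurwitzRemainder (a : ℝ) (s : ℂ) : ℂ :=
  -(s * (s + 1) * (s + 2)) / 6 * mellin (bernoulliKernel a) (-s - 2)

lemma bernoulliCubic_fract {x : ℝ} {n : ℕ} (h0 : n ≤ x) (h1 : x ≤ n + 1) :
    bernoulliCubic (Int.fract x) = bernoulliCubic (x - n) := by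
  rcases h1.lt_or_eq with h | rfl
  · have : ⌊x⌋ = n := by rw [Int.floor_eq_iff]; exact ⟨by exact_mod_cast h0, by exact_mod_cast h⟩
    rw [Int.fract, this]; simp
  · rw [show ((n : ℝ) + 1) = ((n + 1 : ℕ) : ℝ) by push_cast; rfl, Int.fract_natCast]
    simp [bernoulliCubic]

lemma integral_bernoulliCubic_fract_cpow {s : ℂ} (hs : 1 < s.re) {a : ℝ} (ha : 0 < a) (N : ℕ) :
    -(s * (s + 1) * (s + 2)) / 6 *
        ∫ t in a..a + N, (t : ℂ) ^ (-s - 3) * (bernoulliCubic (Int.fract (t - a)) : ℂ) =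
      ∑ n ∈ Finset.range N, (n + a : ℂ) ^ (-s) - (a : ℂ) ^ (-s) / 2 + (N + a : ℂ) ^ (-s) / 2
        + s / 12 * ((N + a : ℂ) ^ (-s - 1) - (a : ℂ) ^ (-s - 1))
        - ((N + a : ℂ) ^ (1 - s) - (a : ℂ) ^ (1 - s)) / (1 - s) := by
  have hii (x y : ℝ) (hx : a ≤ x) (hy : a ≤ y) : IntervalIntegrable
      (fun t : ℝ => (t : ℂ) ^ (-s - 3) * (bernoulliCubic (Int.fract (t - a)) : ℂ))
      MeasureTheory.volume x y := by
    rw [intervalIntegrable_iff]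
    have h := integrableOn_cpow_mul_bernoulliCubic ha (z := -s - 2) (by simp; linarith)
    rw [show -s - 2 - 1 = -s - 3 by ring] at h
    exact h.mono_set fun t ht => lt_of_le_of_lt (le_min hx hy) ht.1
  induction N with
  | zero => simp
  | succ N ih =>
    have hN : (0 : ℝ) ≤ N := N.cast_nonneg
    have hstep : ∫ t in a + N..a + N + 1,
        (t : ℂ) ^ (-s - 3) * (bernoulliCubic (Int.fract (t - a)) : ℂ) =
        ∫ t in a + N..a + N + 1, (t : ℂ) ^ (-s - 3) * (bernoulliCubic (t - (a + N)) : ℂ) := by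
      refine intervalIntegral.integral_congr fun t ht => ?_
      rw [Set.uIcc_of_le (by linarith)] at ht
      rw [bernoulliCubic_fract (n := N) (by linarith [ht.1]) (by linarith [ht.2]), sub_sub]
    have h1 := integral_bernoulliCubic_cpow hs (c := a + N) (by linarith)
    rw [show a + ((N + 1 : ℕ) : ℝ) = a + N + 1 by push_cast; ring,
      ← intervalIntegral.integral_add_adjacent_intervals (b := a + N)
        (hii _ _ le_rfl (by linarith)) (hii _ _ (by linarith) (by linarith)),
      mul_add, ih, hstep, h1, Finset.sum_range_succ]
    push_cast
    rw [show (a : ℂ) + N + 1 = N + 1 + a by ring, show (a : ℂ) + N = N + a by ring]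
    ring

lemma tendsto_natCast_add_cpow {a : ℝ} (ha : 0 < a) {z : ℂ} (hz : z.re < 0) :
    Tendsto (fun N : ℕ => (N + a : ℂ) ^ z) atTop (𝓝 0) := by
  rw [tendsto_zero_iff_norm_tendsto_zero]
  have h : (fun N : ℕ => ‖(N + a : ℂ) ^ z‖) = fun N : ℕ => ((N : ℝ) + a) ^ (-(-z.re)) := by
    ext N
    rw [neg_neg, ← Complex.norm_cpow_eq_rpow_re_of_pos (by positivity)]
    push_cast; rfl
  rw [h]
  exact (tendsto_rpow_neg_atTop (by linarith)).comp
    (tendsto_atTop_add_const_right _ _ tendsto_natCast_atTop_atTop)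

/-- Euler-Maclaurin summation for the Hurwitz zeta function. -/
lemma hasSum_cpow_eq {s : ℂ} (hs : 1 < s.re) {a : ℝ} (ha : 0 < a) {Z : ℂ}
    (hZ : HasSum (fun n : ℕ => (n + a : ℂ) ^ (-s)) Z) :
    Z = (a : ℂ) ^ (1 - s) / (s - 1) + (a : ℂ) ^ (-s) / 2 + s / 12 * (a : ℂ) ^ (-s - 1)
      + hurwitzRemainder a s := by
  have hint := integrableOn_cpow_mul_bernoulliCubic ha (z := -s - 2) (by simp; linarith)
  have hlim := (MeasureTheory.intervalIntegral_tendsto_integral_Ioi a hint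
    (tendsto_atTop_add_const_left _ a (tendsto_natCast_atTop_atTop (R := ℝ)))).const_mul
      (-(s * (s + 1) * (s + 2)) / 6)
  rw [← mellin_bernoulliKernel_eq ha, show -s - 2 - 1 = -s - 3 by ring] at hlim
  simp_rw [integral_bernoulliCubic_fract_cpow hs ha] at hlim
  have t0 := tendsto_natCast_add_cpow ha (z := -s) (by simp; linarith)
  have t1 := tendsto_natCast_add_cpow ha (z := -s - 1) (by simp; linarith)
  have t2 := tendsto_natCast_add_cpow ha (z := 1 - s) (by simp; linarith)
  have hlim' := ((((hZ.tendsto_sum_nat.sub_const ((a : ℂ) ^ (-s) / 2)).add (t0.div_const 2)).add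
    ((t1.sub_const ((a : ℂ) ^ (-s - 1))).const_mul (s / 12))).sub
    ((t2.sub_const ((a : ℂ) ^ (1 - s))).div_const (1 - s)))
  have h := tendsto_nhds_unique hlim' hlim
  have hs1 : s - 1 ≠ 0 := by
    intro h; rw [sub_eq_zero.1 h] at hs; simp at hs
  have hs2 : 1 - s ≠ 0 := by
    intro h; apply hs1; linear_combination -h
  rw [hurwitzRemainder, ← h, show (1 - s) = -(s - 1) by ring]
  field_simp
  ring

lemma norm_hurwitzRemainder_le {a : ℝ} (ha : 1 ≤ a) {s : ℂ} (hs : ‖s - 1‖ = 11 / 4) :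
    ‖hurwitzRemainder a s‖ ≤ 3 / 8 := by
  have hre : |s.re - 1| ≤ 11 / 4 := by simpa [hs] using Complex.abs_re_le_norm (s - 1)
  have hσ : 0 < s.re + 2 := by linarith [(abs_le.1 hre).1]
  have h0 : ‖s‖ ≤ 15 / 4 := by
    calc ‖s‖ = ‖(s - 1) + 1‖ := by ring_nf
      _ ≤ ‖s - 1‖ + ‖(1 : ℂ)‖ := norm_add_le _ _
      _ = 15 / 4 := by rw [hs]; norm_num
  have h1 : ‖s + 1‖ ≤ 19 / 4 := by
    calc ‖s + 1‖ ≤ ‖s‖ + ‖(1 : ℂ)‖ := norm_add_le _ _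
      _ ≤ 19 / 4 := by rw [norm_one]; linarith
  have h2 : ‖s + 2‖ ≤ 251 / 100 * (s.re + 2) := by
    have e1 : (s.re - 1) ^ 2 + s.im ^ 2 = (11 / 4) ^ 2 := by
      rw [← hs, ← Complex.normSq_eq_norm_sq, Complex.normSq_apply]; simp; ring
    refine le_of_sq_le_sq ?_ (by positivity)
    rw [← Complex.normSq_eq_norm_sq, Complex.normSq_apply]
    simp only [add_re, re_ofNat, add_im, im_ofNat, add_zero]
    nlinarith [sq_nonneg (s.re + 1524 / 1000)]
  have hm := norm_mellin_bernoulliKernel_le ha (z := -s - 2) (by simp; linarith)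
  have hz : -(-s - 2 : ℂ).re = s.re + 2 := by simp; ring
  rw [hz] at hm
  rw [hurwitzRemainder, norm_mul, norm_div, norm_neg, norm_mul, norm_mul]
  calc _ ≤ 15 / 4 * (19 / 4) * (251 / 100 * (s.re + 2)) / ‖(6 : ℂ)‖ * (1 / 20 / (s.re + 2)) := by
        gcongr
    _ = 15 / 4 * (19 / 4) * (251 / 100) / 120 := by
        rw [Complex.norm_ofNat]; field_simp; norm_num
    _ ≤ 3 / 8 := by norm_num

lemma differentiableOn_hurwitzRemainder {a : ℝ} (ha : 0 < a) :
    DifferentiableOn ℂ (hurwitzRemainder a) (Metric.closedBall 1 (11 / 4)) := by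
  intro s hs
  have hs' : ‖s - 1‖ ≤ 11 / 4 := by simpa [dist_eq_norm] using hs
  have hre : |s.re - 1| ≤ 11 / 4 := by simpa using (Complex.abs_re_le_norm (s - 1)).trans hs'
  have h := differentiableAt_mellin_bernoulliKernel ha (z := -s - 2)
    (by simp; linarith [(abs_le.1 hre).1])
  have h' : DifferentiableAt ℂ (fun s => mellin (bernoulliKernel a) (-s - 2)) s :=
    DifferentiableAt.comp (g := mellin (bernoulliKernel a)) (f := fun s => -s - 2) s h (by fun_prop)
  unfold hurwitzRemainder
  exact DifferentiableAt.differentiableWithinAt (by fun_prop)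

/-- The Taylor coefficients of `hurwitzRemainder a` at `1`. -/
noncomputable def remainderCoeff (a : ℝ) (m : ℕ) : ℂ :=
  (m.factorial : ℂ)⁻¹ * iteratedDeriv m (hurwitzRemainder a) 1

lemma hasSum_remainderCoeff {a : ℝ} (ha : 0 < a) {s : ℂ} (hs : ‖s - 1‖ < 11 / 4) :
    HasSum (fun m => remainderCoeff a m * (s - 1) ^ m) (hurwitzRemainder a s) := by
  have h := Complex.hasSum_taylorSeries_on_ball (c := 1) (r := 11 / 4) (z := s)
    ((differentiableOn_hurwitzRemainder ha).mono Metric.ball_subset_closedBall)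
    (by simpa [dist_eq_norm] using hs)
  refine h.congr_fun fun m => ?_
  simp only [remainderCoeff, smul_eq_mul]
  ring

lemma norm_remainderCoeff_le {a : ℝ} (ha : 1 ≤ a) (m : ℕ) :
    ‖remainderCoeff a m‖ ≤ 3 / 8 / (11 / 4) ^ m := by
  have hd : DiffContOnCl ℂ (hurwitzRemainder a) (Metric.ball 1 (11 / 4)) := by
    apply DifferentiableOn.diffContOnCl
    rw [closure_ball _ (by norm_num)]
    exact differentiableOn_hurwitzRemainder (by linarith)
  have h := Complex.norm_iteratedDeriv_le_of_forall_mem_sphere_norm_le (C := 3 / 8) m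
    (by norm_num) hd fun z hz => norm_hurwitzRemainder_le ha (by simpa [dist_eq_norm] using hz)
  rw [remainderCoeff, norm_mul, norm_inv, Complex.norm_natCast]
  have hm : (0 : ℝ) < m.factorial := by positivity
  rw [inv_mul_le_iff₀ hm]
  exact h.trans_eq (by ring)

lemma eq_zero_of_hasSum_pow_eq_zero {c : ℕ → ℂ}
    (h : ∀ᶠ x : ℝ in 𝓝[>] 0, HasSum (fun m => c m * (x : ℂ) ^ m) 0) : c = 0 := by
  set p := FormalMultilinearSeries.ofScalars ℂ c with hp
  obtain ⟨x₀, hx₀, hpos⟩ := (h.and self_mem_nhdsWithin).exists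
  have hx₀' : (0 : ℝ) < x₀ := hpos
  lift x₀ to NNReal using hx₀'.le
  have hrad : 0 < p.radius := by
    refine lt_of_lt_of_le ?_ (p.le_radius_of_tendsto (r := x₀) (l := 0) ?_)
    · exact_mod_cast hx₀'
    · have := hx₀.summable.tendsto_atTop_zero.norm
      simpa [hp, FormalMultilinearSeries.ofScalars_norm] using this
  have hball := p.hasFPowerSeriesOnBall hrad
  have hfreq : ∃ᶠ z in 𝓝[≠] (0 : ℂ), p.sum z = 0 := by
    have ht : Tendsto (fun x : ℝ => (x : ℂ)) (𝓝[>] 0) (𝓝[≠] 0) := by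
      refine tendsto_nhdsWithin_iff.2 ⟨?_, ?_⟩
      · exact (Complex.continuous_ofReal.tendsto' 0 0 (by simp)).mono_left nhdsWithin_le_nhds
      · filter_upwards [self_mem_nhdsWithin] with x hx
        have : (0 : ℝ) < x := hx
        simpa using this.ne'
    refine ht.frequently (h.mono fun x hx => ?_).frequently
    have e : p.sum (x : ℂ) = ∑' n, c n • (x : ℂ) ^ n :=
      FormalMultilinearSeries.ofScalars_sum_eq c (x : ℂ)
    rw [e]
    exact hx.tsum_eq
  have hz := hball.analyticAt.frequently_zero_iff_eventually_zero.1 hfreq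
  have hp0 := hball.hasFPowerSeriesAt.eq_zero_of_eventually hz
  rwa [hp, FormalMultilinearSeries.ofScalars_series_eq_zero] at hp0

lemma cpow_neg_one_sub {a : ℝ} (ha : 0 < a) (w : ℂ) :
    (a : ℂ) ^ (-(1 + w)) = (a : ℂ)⁻¹ * Complex.exp (-(Real.log a : ℂ) * w) := by
  have ha' : (a : ℂ) ≠ 0 := by exact_mod_cast ha.ne'
  rw [neg_add, Complex.cpow_add _ _ ha', Complex.cpow_neg_one, Complex.cpow_def_of_ne_zero ha',
    Complex.ofReal_log ha.le]
  ring_nf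

lemma hasSum_exp_coeff (z w : ℂ) :
    HasSum (fun m : ℕ => z ^ m / m.factorial * w ^ m) (Complex.exp (z * w)) := by
  have h := NormedSpace.expSeries_div_hasSum_exp (z * w)
  rw [← Complex.exp_eq_exp_ℂ] at h
  refine h.congr_fun fun m => ?_
  rw [mul_pow]; ring

lemma hasSum_mul_exp_coeff (z w : ℂ) :
    HasSum (fun m : ℕ => m * z ^ (m - 1) / m.factorial * w ^ m) (w * Complex.exp (z * w)) := by
  rw [← hasSum_nat_add_iff' 1]
  simp only [Finset.range_one, Finset.sum_singleton, Nat.cast_zero, zero_mul, zero_div, sub_zero]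
  refine ((hasSum_exp_coeff z w).mul_left w).congr_fun fun m => ?_
  rw [Nat.factorial_succ, Nat.add_sub_cancel]
  have : (m.factorial : ℂ) ≠ 0 := by exact_mod_cast m.factorial_ne_zero
  have : (m + 1 : ℂ) ≠ 0 := by exact_mod_cast m.succ_ne_zero
  push_cast
  field_simp
  ring

lemma hasSum_exp_sub_one_div_coeff (z : ℂ) {w : ℂ} (hw : w ≠ 0) :
    HasSum (fun m : ℕ => z ^ (m + 1) / (m + 1).factorial * w ^ m)
      ((Complex.exp (z * w) - 1) / w) := by
  have h := (hasSum_nat_add_iff' 1).2 (hasSum_exp_coeff z w)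
  simp only [Finset.range_one, Finset.sum_singleton, pow_zero, Nat.factorial_zero, Nat.cast_one,
    div_one, mul_one] at h
  refine (h.div_const w).congr_fun fun m => ?_
  field_simp
  ring

lemma factorial_term_le {r : ℕ} (hr : 1 ≤ r) :
    (7 / 10 : ℝ) ^ (r - 1) * (49 / 100 / (r + 1) + r / 12) + r.factorial * (3 / 8 / (11 / 4) ^ r) ≤
      Real.exp 1 * ((r : ℝ) / (2 * Real.exp 1)) ^ r := by
  have he : 0 < Real.exp 1 := Real.exp_pos 1
  have he1 := Real.exp_one_lt_d9
  rcases hr.eq_or_lt with rfl | hr2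
  · have : Real.exp 1 * (((1 : ℕ) : ℝ) / (2 * Real.exp 1)) ^ 1 = 1 / 2 := by
      push_cast; field_simp
    rw [this]
    norm_num
  · replace hr2 : 2 ≤ r := hr2
    clear hr
    induction r, hr2 using Nat.le_induction with
    | base =>
      have : Real.exp 1 * (((2 : ℕ) : ℝ) / (2 * Real.exp 1)) ^ 2 = 1 / Real.exp 1 := by
        push_cast; field_simp
      rw [this, le_div_iff₀ he]
      norm_num [Nat.factorial]
      linarith
    | succ r hr2 ih =>
      have hr : (2 : ℝ) ≤ r := by exact_mod_cast hr2
      have hr0 : (0 : ℝ) < r := by linarith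
      obtain ⟨k, rfl⟩ : ∃ k, r = k + 1 := ⟨r - 1, by omega⟩
      set x : ℝ := ((k + 1 : ℕ) : ℝ) with hx
      set e := Real.exp 1
      have hQ : (x + 1) / e * (e * (x / (2 * e)) ^ (k + 1)) ≤
          e * ((x + 1) / (2 * e)) ^ (k + 1 + 1) := by
        have hb : 2 * x ^ (k + 1) ≤ (x + 1) ^ (k + 1) := by
          have h := one_add_mul_le_pow (a := 1 / x) (by have : 0 < 1 / x := by positivity
                                                        linarith) (k + 1)
          rw [← hx, mul_one_div_cancel hr0.ne'] at h
          calc 2 * x ^ (k + 1) ≤ (1 + 1 / x) ^ (k + 1) * x ^ (k + 1) := by gcongr; linarith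
            _ = (x + 1) ^ (k + 1) := by rw [← mul_pow]; congr 1; field_simp
        rw [pow_succ _ (k + 1), div_pow, div_pow]
        calc _ = (x + 1) / 2 / (2 * e) ^ (k + 1) * (2 * x ^ (k + 1)) := by field_simp
          _ ≤ (x + 1) / 2 / (2 * e) ^ (k + 1) * (x + 1) ^ (k + 1) := by gcongr
          _ = _ := by field_simp
      have hP : (7 / 10 : ℝ) ^ (k + 1) * (49 / 100 / (x + 1 + 1) + (x + 1) / 12) ≤
          (x + 1) / e * ((7 / 10 : ℝ) ^ k * (49 / 100 / (x + 1) + x / 12)) := by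
        have h1 : 7 / 10 / x ≤ 1 / e := by
          rw [div_le_div_iff₀ hr0 he]; linarith
        have h2 : 49 / 100 / (x + 1 + 1) ≤ 49 / 100 / x := by gcongr; linarith
        calc _ ≤ (7 / 10 : ℝ) ^ (k + 1) * (49 / 100 / x + (x + 1) / 12) := by gcongr
          _ = (7 / 10 / x) * ((x + 1) * ((7 / 10 : ℝ) ^ k * (49 / 100 / (x + 1) + x / 12))) := by
            rw [pow_succ]; field_simp
          _ ≤ 1 / e * ((x + 1) * ((7 / 10 : ℝ) ^ k * (49 / 100 / (x + 1) + x / 12))) := by gcongr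
          _ = _ := by ring
      have hF : ((k + 1 + 1).factorial : ℝ) * (3 / 8 / (11 / 4) ^ (k + 1 + 1)) ≤
          (x + 1) / e * ((k + 1).factorial * (3 / 8 / (11 / 4) ^ (k + 1))) := by
        have h1 : 1 / (11 / 4) ≤ 1 / e := by gcongr; linarith
        rw [Nat.factorial_succ (k + 1), pow_succ _ (k + 1)]
        calc _ = 1 / (11 / 4) *
              ((x + 1) * ((k + 1).factorial * (3 / 8 / (11 / 4 : ℝ) ^ (k + 1)))) := by
              rw [hx]; push_cast; field_simp
          _ ≤ 1 / e * ((x + 1) * ((k + 1).factorial * (3 / 8 / (11 / 4 : ℝ) ^ (k + 1)))) := by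
              gcongr
          _ = _ := by ring
      have ih' := mul_le_mul_of_nonneg_left ih (show 0 ≤ (x + 1) / e by positivity)
      rw [mul_add] at ih'
      have hc : ((k + 1 + 1 : ℕ) : ℝ) = x + 1 := by rw [hx]; push_cast; ring
      rw [hc]
      simp only [Nat.add_sub_cancel] at ih' ⊢
      linarith

lemma abs_boundary_term_le {L a : ℝ} (hL0 : 0 ≤ L) (hL : L ≤ 7 / 10) (hLa : L ≤ a - 1)
    (ha : 1 ≤ a) (k : ℕ) :
    |-(L ^ (k + 2) / (k + 2)) + L ^ (k + 1) / (2 * a)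
        + (L ^ (k + 1) - (k + 1) * L ^ k) / (12 * a ^ 2)| ≤
      (7 / 10 : ℝ) ^ k * (49 / 100 / (k + 2) + (k + 1) / 12) := by
  have hk : (0 : ℝ) ≤ k := k.cast_nonneg
  have e : -(L ^ (k + 2) / (k + 2)) + L ^ (k + 1) / (2 * a)
        + (L ^ (k + 1) - (k + 1) * L ^ k) / (12 * a ^ 2) =
      L ^ k * (-(L ^ 2 / (k + 2)) + L / (2 * a) - (k + 1 - L) / (12 * a ^ 2)) := by
    ring
  have h1 : L / (2 * a) ≤ 1 / 4 := by
    rw [div_le_iff₀ (by linarith)]; linarith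
  have h1' : 0 ≤ L / (2 * a) := by positivity
  have h2 : 0 ≤ (k + 1 - L) / (12 * a ^ 2) := div_nonneg (by linarith) (by positivity)
  have h3 : (k + 1 - L) / (12 * a ^ 2) ≤ (k + 1) / 12 := by
    gcongr
    · linarith
    · nlinarith
  have h4 : L ^ 2 / (k + 2) ≤ 49 / 100 / (k + 2) := by
    gcongr; nlinarith
  have h4' : 0 ≤ L ^ 2 / (k + 2) := by positivity
  have h5 : (1 / 4 : ℝ) ≤ 49 / 100 / (k + 2) + (k + 1) / 12 := by
    rw [div_add_div _ _ (by positivity) (by norm_num), le_div_iff₀ (by positivity)]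
    rcases Nat.lt_or_ge k 2 with h | h
    · interval_cases k <;> norm_num
    · have : (2 : ℝ) ≤ k := by exact_mod_cast h
      nlinarith
  rw [e, abs_mul, abs_of_nonneg (by positivity)]
  gcongr
  rw [abs_le]
  constructor <;> linarith

lemma hasSum_hurwitzZeta_sub_pole {α : ℝ} (hα : 0 < α) (hα1 : α ≤ 1) {x : ℝ} (hx : 0 < x)
    (hx2 : x < 11 / 4) :
    HasSum (fun m : ℕ =>
      ((α : ℂ)⁻¹ * ((-(Real.log α : ℂ)) ^ m / m.factorial)
        + ((-(Real.log (1 + α) : ℂ)) ^ (m + 1) / (m + 1).factorial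
          + ((1 + α : ℝ) : ℂ)⁻¹ / 2 * ((-(Real.log (1 + α) : ℂ)) ^ m / m.factorial)
          + (((1 + α : ℝ) : ℂ)⁻¹ ^ 2 / 12 * ((-(Real.log (1 + α) : ℂ)) ^ m / m.factorial
            + m * (-(Real.log (1 + α) : ℂ)) ^ (m - 1) / m.factorial))
          + remainderCoeff (1 + α) m)) * (x : ℂ) ^ m)
      (HurwitzZeta.hurwitzZeta (α : UnitAddCircle) (1 + x) - 1 / x) := by
  have hs : 1 < (1 + x : ℂ).re := by simpa using hx
  have hx0 : (x : ℂ) ≠ 0 := by exact_mod_cast hx.ne'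
  have ha : (0 : ℝ) < 1 + α := by linarith
  have ha0 : ((1 + α : ℝ) : ℂ) ≠ 0 := by exact_mod_cast ha.ne'
  have hz := HurwitzZeta.hasSum_hurwitzZeta_of_one_lt_re ⟨hα.le, hα1⟩ hs
  have hz' := (hasSum_nat_add_iff' 1).2 hz
  have hZ : HasSum (fun n : ℕ => (n + (1 + α : ℝ) : ℂ) ^ (-(1 + x : ℂ)))
      (HurwitzZeta.hurwitzZeta (α : UnitAddCircle) (1 + x) - (α : ℂ) ^ (-(1 + x : ℂ))) := by
    simp only [Finset.range_one, Finset.sum_singleton, Nat.cast_zero, zero_add, one_div,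
      ← Complex.cpow_neg] at hz'
    refine hz'.congr_fun fun n => ?_
    push_cast
    ring_nf
  have hem := hasSum_cpow_eq hs ha hZ
  have c0 : ((1 + α : ℝ) : ℂ) ^ (-(1 + x : ℂ)) =
      ((1 + α : ℝ) : ℂ)⁻¹ * Complex.exp (-(Real.log (1 + α) : ℂ) * x) := cpow_neg_one_sub ha x
  have c1 : ((1 + α : ℝ) : ℂ) ^ (-(1 + x : ℂ) - 1) =
      ((1 + α : ℝ) : ℂ)⁻¹ ^ 2 * Complex.exp (-(Real.log (1 + α) : ℂ) * x) := by
    rw [Complex.cpow_sub _ _ ha0, c0, Complex.cpow_one]; ring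
  have c2 : ((1 + α : ℝ) : ℂ) ^ (1 - (1 + x : ℂ)) =
      Complex.exp (-(Real.log (1 + α) : ℂ) * x) := by
    rw [show (1 - (1 + x : ℂ)) = -(1 + x) + 1 by ring, Complex.cpow_add _ _ ha0, c0,
      Complex.cpow_one]
    field_simp
  rw [c0, c1, c2, cpow_neg_one_sub hα, add_sub_cancel_left] at hem
  have hr := hasSum_remainderCoeff ha (s := 1 + x) (by
    rw [add_sub_cancel_left, Complex.norm_real, Real.norm_of_nonneg hx.le]; exact hx2)
  rw [add_sub_cancel_left] at hr
  have hE := hasSum_exp_coeff (-(Real.log (1 + α) : ℂ)) x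
  have key := ((hasSum_exp_coeff (-(Real.log α : ℂ)) x).mul_left (α : ℂ)⁻¹).add
    ((((hasSum_exp_sub_one_div_coeff (-(Real.log (1 + α) : ℂ)) hx0).add
      (hE.mul_left (((1 + α : ℝ) : ℂ)⁻¹ / 2))).add
      ((hE.add (hasSum_mul_exp_coeff (-(Real.log (1 + α) : ℂ)) x)).mul_left
        (((1 + α : ℝ) : ℂ)⁻¹ ^ 2 / 12))).add hr)
  have hval : HurwitzZeta.hurwitzZeta (α : UnitAddCircle) (1 + x) - 1 / x =
      (α : ℂ)⁻¹ * Complex.exp (-(Real.log α : ℂ) * x)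
      + ((Complex.exp (-(Real.log (1 + α) : ℂ) * x) - 1) / x
        + ((1 + α : ℝ) : ℂ)⁻¹ / 2 * Complex.exp (-(Real.log (1 + α) : ℂ) * x)
        + ((1 + α : ℝ) : ℂ)⁻¹ ^ 2 / 12 * (Complex.exp (-(Real.log (1 + α) : ℂ) * x)
          + x * Complex.exp (-(Real.log (1 + α) : ℂ) * x))
        + hurwitzRemainder (1 + α) (1 + x)) := by
    linear_combination hem
  rw [hval]
  refine key.congr_fun fun m => ?_
  ring

lemma log_one_add_le {α : ℝ} (hα : 0 < α) (hα1 : α ≤ 1) : Real.log (1 + α) ≤ 7 / 10 :=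
  (Real.log_le_log (by linarith) (show 1 + α ≤ 2 by linarith)).trans
    (by linarith [Real.log_two_lt_d9])

/-- if `γ r` are the Laurent coefficients of the Hurwitz zeta function `ζ(s,α)`
at `s = 1`, then for `r ≥ 1` and `0 < α ≤ 1`,
`|γ_r(α) - (-1)^r (log α)^r/(r!·α)| ≤ e·(1/r!)·(r/(2e))^r`. -/
theorem stmt6 (α : ℝ) (hα : 0 < α) (hα1 : α ≤ 1)
    (γ : ℕ → ℂ)
    (hγ : ∀ᶠ s : ℂ in 𝓝[≠] 1, HasSum (fun m : ℕ => γ m * (s - 1) ^ m)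
      (HurwitzZeta.hurwitzZeta (α : UnitAddCircle) s - 1 / (s - 1)))
    (r : ℕ) (hr : 1 ≤ r) :
    ‖γ r - (-1) ^ r * ((Real.log α : ℂ) ^ r / ((Nat.factorial r : ℂ) * α))‖ ≤
      Real.exp 1 * (1 / (Nat.factorial r : ℝ)) * ((r : ℝ) / (2 * Real.exp 1)) ^ r := by
  have ht : Tendsto (fun x : ℝ => (1 + x : ℂ)) (𝓝[>] 0) (𝓝[≠] 1) := by
    refine tendsto_nhdsWithin_iff.2 ⟨?_, ?_⟩
    · have hc : Continuous fun x : ℝ => (1 + x : ℂ) := by fun_prop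
      exact (hc.tendsto' 0 1 (by simp)).mono_left nhdsWithin_le_nhds
    · filter_upwards [self_mem_nhdsWithin] with x hx
      have : (0 : ℝ) < x := hx
      simpa using this.ne'
  have hcoeff := eq_zero_of_hasSum_pow_eq_zero (c := fun m => γ m - _) (by
    filter_upwards [ht.eventually hγ, self_mem_nhdsWithin,
      mem_nhdsWithin_of_mem_nhds (Iio_mem_nhds (show (0 : ℝ) < 11 / 4 by norm_num))] with x h1 hx hx2
    rw [add_sub_cancel_left] at h1
    have h := h1.sub (hasSum_hurwitzZeta_sub_pole hα hα1 hx hx2)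
    rw [sub_self] at h
    refine h.congr_fun fun m => ?_
    rw [← sub_mul])
  obtain ⟨k, rfl⟩ : ∃ k, r = k + 1 := ⟨r - 1, by omega⟩
  have hk := sub_eq_zero.1 (congrFun hcoeff (k + 1))
  set L := Real.log (1 + α)
  have hα0 : (α : ℂ) ≠ 0 := by exact_mod_cast hα.ne'
  have ha0 : ((1 + α : ℝ) : ℂ) ≠ 0 := by
    have : (1 + α : ℝ) ≠ 0 := by linarith
    exact_mod_cast this
  have hf : ((k + 1).factorial : ℂ) ≠ 0 := by exact_mod_cast (k + 1).factorial_ne_zero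
  have hk2 : (k + 2 : ℂ) ≠ 0 := by exact_mod_cast (k + 1).succ_ne_zero
  have hmain : γ (k + 1) - (-1) ^ (k + 1) *
      ((Real.log α : ℂ) ^ (k + 1) / (((k + 1).factorial : ℂ) * α)) =
      (-1) ^ (k + 1) / (k + 1).factorial * ((-(L ^ (k + 2) / (k + 2)) + L ^ (k + 1) / (2 * (1 + α))
        + (L ^ (k + 1) - (k + 1) * L ^ k) / (12 * (1 + α) ^ 2) : ℝ) : ℂ)
        + remainderCoeff (1 + α) (k + 1) := by
    rw [hk, Nat.factorial_succ (k + 1), Nat.add_sub_cancel, neg_pow (Real.log α : ℂ),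
      neg_pow (L : ℂ) (k + 1 + 1), neg_pow (L : ℂ) (k + 1), neg_pow (L : ℂ) k]
    push_cast at ha0 ⊢
    rw [show (k + 1 + 1 : ℂ) = k + 2 by ring]
    field_simp
    ring
  have hfpos : (0 : ℝ) < (k + 1).factorial := by positivity
  have hB := abs_boundary_term_le (Real.log_nonneg (show 1 ≤ 1 + α by linarith))
    (log_one_add_le hα hα1) (Real.log_le_sub_one_of_pos (show 0 < 1 + α by linarith))
    (by linarith) k
  have hR := norm_remainderCoeff_le (show 1 ≤ 1 + α by linarith) (k + 1)
  have hN := factorial_term_le hr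
  rw [hmain]
  calc _ ≤ 1 / (k + 1).factorial * ((7 / 10 : ℝ) ^ k * (49 / 100 / (k + 2) + (k + 1) / 12))
        + 3 / 8 / (11 / 4) ^ (k + 1) := by
        refine (norm_add_le _ _).trans (add_le_add ?_ hR)
        rw [norm_mul, norm_div, norm_pow, norm_neg, norm_one, one_pow, Complex.norm_natCast,
          Complex.norm_real, Real.norm_eq_abs]
        gcongr
    _ = 1 / (k + 1).factorial * ((7 / 10 : ℝ) ^ (k + 1 - 1) *
          (49 / 100 / ((k + 1 : ℕ) + 1) + (k + 1 : ℕ) / 12)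
          + (k + 1).factorial * (3 / 8 / (11 / 4) ^ (k + 1))) := by
        rw [Nat.add_sub_cancel]
        push_cast
        rw [show (k + 1 + 1 : ℝ) = k + 2 by ring]
        field_simp
    _ ≤ 1 / (k + 1).factorial *
          (Real.exp 1 * (((k + 1 : ℕ) : ℝ) / (2 * Real.exp 1)) ^ (k + 1)) := by gcongr
    _ = _ := by ring
end

section
/- For a primitive Dirichlet character χ modulo q ≥ 3 and every integer r ≥ 1, L^{(r)}(1,χ) = (-1)^r ∑_{n ≤ q·e^{r/2}} χ(n)(log n)^r/n + O( q^{-1/2} e^{-r/2} log q · (log q + r/2)^r ), with an absolute implied constant; in particular |L^{(r)}(1,χ)| ≪ (log q + r/2)^{r+1}. -/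
open Complex Filter Topology

/-- The Gauss sum of a primitive character mod `N` has absolute value `√N`. -/
lemma DirichletCharacter.IsPrimitive.norm_gaussSum_stdAddChar_sq {N : ℕ} [NeZero N]
    {χ : DirichletCharacter ℂ N} (hχ : χ.IsPrimitive) :
    ‖gaussSum χ ZMod.stdAddChar‖ ^ 2 = N := by
  have h := congrFun (ZMod.dft_dft (χ : ZMod N → ℂ)) (-1)
  have h1 : ZMod.dft (χ : ZMod N → ℂ) =
      fun k ↦ χ⁻¹ (-k) * gaussSum χ ZMod.stdAddChar :=
    funext hχ.fourierTransform_eq_inv_mul_gaussSum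
  simp only [neg_neg, map_one, smul_eq_mul, mul_one] at h
  rw [h1, ZMod.dft_mul_const, ZMod.dft_comp_neg] at h
  simp only [neg_neg] at h
  rw [fourierTransform_eq_gaussSum_mulShift] at h
  have h2 : (ZMod.stdAddChar (N := N)).mulShift (-1) = (ZMod.stdAddChar)⁻¹ :=
    AddChar.inv_mulShift _ |>.symm
  rw [h2, ← star_gaussSum_eq] at h
  have h3 := Complex.conj_mul' (gaussSum χ ZMod.stdAddChar)
  rw [starRingEnd_apply, h] at h3
  exact_mod_cast h3.symm

lemma two_mul_mul_one_sub_le_sin_pi_mul {x : ℝ} (h0 : 0 ≤ x) (h1 : x ≤ 1) :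
    2 * x * (1 - x) ≤ Real.sin (Real.pi * x) := by
  wlog h : x ≤ 1 / 2 generalizing x
  · have := this (x := 1 - x) (by linarith) (by linarith) (by linarith)
    rw [show Real.pi * (1 - x) = Real.pi - Real.pi * x by ring, Real.sin_pi_sub] at this
    linarith
  have := Real.mul_le_sin (x := Real.pi * x) (by positivity) (by nlinarith [Real.pi_pos])
  rw [show 2 / Real.pi * (Real.pi * x) = 2 * x by field_simp] at this
  nlinarith

/-- A geometric sum of the additive character `e(a/q)`, `0 < a < q`. -/
lemma norm_sum_stdAddChar_pow_le {q : ℕ} [NeZero q] {a : ℕ} (ha : 0 < a) (haq : a < q) (M : ℕ) :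
    ‖∑ n ∈ Finset.range M, ZMod.stdAddChar (a : ZMod q) ^ n‖ ≤
      q / 2 * ((a : ℝ)⁻¹ + ((q - a : ℕ) : ℝ)⁻¹) := by
  have hqR : (0 : ℝ) < q := by exact_mod_cast ha.trans haq
  have haR : (0 : ℝ) < a := by exact_mod_cast ha
  have haqR : (a : ℝ) < q := by exact_mod_cast haq
  set z := ZMod.stdAddChar (a : ZMod q) with hz
  have hz1 : ‖z‖ = 1 := by rw [hz, ZMod.stdAddChar_apply]; exact Circle.norm_coe _
  have hzsub : ‖z - 1‖ = 2 * Real.sin (Real.pi * (a / q)) := by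
    have : z = Complex.exp (I * ((2 * Real.pi * (a / q) : ℝ) : ℂ)) := by
      have := ZMod.stdAddChar_coe (N := q) (a : ℤ)
      rw [Int.cast_natCast] at this
      rw [hz, this]
      congr 1
      push_cast
      ring
    have hpos : 0 ≤ Real.sin (Real.pi * (a / q)) := by
      apply Real.sin_nonneg_of_nonneg_of_le_pi (by positivity)
      have : (a : ℝ) / q ≤ 1 := (div_le_one hqR).2 haqR.le
      nlinarith [Real.pi_pos]
    rw [this, Complex.norm_exp_I_mul_ofReal_sub_one,
      show 2 * Real.pi * ((a : ℝ) / q) / 2 = Real.pi * (a / q) by ring, Real.norm_eq_abs,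
      abs_of_nonneg (by positivity)]
  have hlow : 4 * (a / q : ℝ) * (1 - a / q) ≤ ‖z - 1‖ := by
    have := two_mul_mul_one_sub_le_sin_pi_mul (x := (a : ℝ) / q) (by positivity)
      ((div_le_one hqR).2 haqR.le)
    linarith
  have hsubpos : (0 : ℝ) < 1 - a / q := by
    rw [sub_pos, div_lt_one hqR]; exact haqR
  have hzpos : 0 < ‖z - 1‖ := lt_of_lt_of_le (by positivity) hlow
  rw [geom_sum_eq (fun h ↦ by simp [h] at hzpos), norm_div]
  have hnum : ‖z ^ M - 1‖ ≤ 2 := by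
    calc ‖z ^ M - 1‖ ≤ ‖z ^ M‖ + ‖(1 : ℂ)‖ := norm_sub_le _ _
      _ = 2 := by rw [norm_pow, hz1]; norm_num
  calc ‖z ^ M - 1‖ / ‖z - 1‖ ≤ 2 / (4 * (a / q : ℝ) * (1 - a / q)) := by gcongr
    _ = q / 2 * ((a : ℝ)⁻¹ + ((q - a : ℕ) : ℝ)⁻¹) := by
      rw [Nat.cast_sub haq.le]
      have : (q : ℝ) - a ≠ 0 := (sub_pos.2 haqR).ne'
      field_simp
      ring

lemma ZMod.sum_eq_sum_range {E : Type*} [AddCommMonoid E] {q : ℕ} [NeZero q] (f : ZMod q → E) :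
    ∑ j, f j = ∑ n ∈ Finset.range q, f n := by
  refine Finset.sum_nbij' (fun j ↦ j.val) (fun n ↦ (n : ZMod q)) (fun j _ ↦ ?_) (fun n _ ↦ ?_)
    (fun j _ ↦ ?_) (fun n hn ↦ ?_) (fun j _ ↦ ?_)
  · simpa using ZMod.val_lt j
  · simp
  · simp
  · exact ZMod.val_cast_of_lt (Finset.mem_range.1 hn)
  · simp

/-- The **Pólya–Vinogradov inequality**. -/
lemma DirichletCharacter.IsPrimitive.norm_sum_range_le {q : ℕ} [NeZero q] (hq : 3 ≤ q)
    {χ : DirichletCharacter ℂ q} (hχ : χ.IsPrimitive) (M : ℕ) :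
    ‖∑ n ∈ Finset.range M, χ n‖ ≤ 2 * √q * Real.log q := by
  have hqR : (0 : ℝ) < q := by exact_mod_cast (by omega : 0 < q)
  set τ := gaussSum χ ZMod.stdAddChar with hτ
  have hτn : ‖τ‖ = √q := by
    rw [← hχ.norm_gaussSum_stdAddChar_sq, Real.sqrt_sq (norm_nonneg _)]
  have hconj : ‖∑ n ∈ Finset.range M, χ n‖ = ‖∑ n ∈ Finset.range M, χ⁻¹ n‖ := by
    rw [← norm_star, star_sum]
    simp only [MulChar.star_apply']
  have hfour : (∑ n ∈ Finset.range M, χ⁻¹ n) * τ =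
      ∑ j : ZMod q, χ j * ∑ n ∈ Finset.range M, ZMod.stdAddChar j ^ n := by
    simp only [Finset.sum_mul, Finset.mul_sum]
    rw [Finset.sum_comm]
    refine Finset.sum_congr rfl fun n _ ↦ ?_
    have := hχ.fourierTransform_eq_inv_mul_gaussSum (-(n : ZMod q))
    rw [neg_neg, ZMod.dft_apply] at this
    rw [hτ, ← this]
    refine Finset.sum_congr rfl fun j _ ↦ ?_
    rw [smul_eq_mul, mul_comm, ← AddChar.map_nsmul_eq_pow, nsmul_eq_mul, mul_neg, neg_neg,
      mul_comm j]
  have hsum : ‖∑ j : ZMod q, χ j * ∑ n ∈ Finset.range M, ZMod.stdAddChar j ^ n‖ ≤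
      q * (1 + Real.log q) := by
    rw [ZMod.sum_eq_sum_range, Finset.range_eq_Ico, Finset.sum_eq_sum_Ico_succ_bot (by omega)]
    have h0 : χ ((0 : ℕ) : ZMod q) = 0 := by
      have : Fact (1 < q) := ⟨by omega⟩
      rw [Nat.cast_zero]
      exact χ.map_nonunit not_isUnit_zero
    rw [h0, zero_mul, zero_add]
    have hrefl : ∑ a ∈ Finset.Ico 1 q, ((q - a : ℕ) : ℝ)⁻¹ = ∑ a ∈ Finset.Ico 1 q, (a : ℝ)⁻¹ := by
      have := Finset.sum_Ico_reflect (fun n : ℕ ↦ (n : ℝ)⁻¹) 1 (m := q) (n := q) (by omega)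
      rw [this]
      congr 1
      rw [show q + 1 - q = 1 by omega, show q + 1 - 1 = q by omega]
    have hharm : ∑ a ∈ Finset.Ico 1 q, (a : ℝ)⁻¹ ≤ 1 + Real.log q := by
      refine le_trans ?_ (harmonic_le_one_add_log q)
      rw [harmonic_eq_sum_Icc]
      push_cast
      refine Finset.sum_le_sum_of_subset_of_nonneg (fun a ha ↦ ?_) fun _ _ _ ↦ by positivity
      simp only [Finset.mem_Ico, Finset.mem_Icc] at ha ⊢
      omega
    calc _ ≤ ∑ a ∈ Finset.Ico (0 + 1) q, (q : ℝ) / 2 * ((a : ℝ)⁻¹ + ((q - a : ℕ) : ℝ)⁻¹) := by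
          refine norm_sum_le_of_le _ fun a ha ↦ ?_
          simp only [Finset.mem_Ico] at ha
          rw [norm_mul]
          refine (mul_le_of_le_one_left (norm_nonneg _) (χ.norm_le_one _)).trans ?_
          exact norm_sum_stdAddChar_pow_le (by omega) ha.2 M
      _ = q * ∑ a ∈ Finset.Ico 1 q, (a : ℝ)⁻¹ := by
          rw [← Finset.mul_sum, Finset.sum_add_distrib, zero_add, hrefl]; ring
      _ ≤ _ := by gcongr
  have hlog : 1 ≤ Real.log q := by
    rw [Real.le_log_iff_exp_le hqR]
    have : (3 : ℝ) ≤ q := by exact_mod_cast hq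
    linarith [Real.exp_one_lt_d9]
  rw [← hfour, norm_mul, hτn] at hsum
  rw [hconj, ← mul_le_mul_iff_left₀ (Real.sqrt_pos.2 hqR)]
  calc _ ≤ _ := hsum
    _ ≤ q * (2 * Real.log q) := by gcongr; linarith
    _ = (√q * √q) * (2 * Real.log q) := by rw [Real.mul_self_sqrt hqR.le]
    _ = _ := by ring

/-- Summation by parts on `[N, M)`. -/
lemma sum_Ico_sub_mul_eq {R : Type*} [CommRing R] (V f : ℕ → R) {N M : ℕ} (h : N ≤ M) :
    ∑ n ∈ Finset.Ico N M, (V (n + 1) - V n) * f n =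
      V M * f M - V N * f N - ∑ n ∈ Finset.Ico N M, V (n + 1) * (f (n + 1) - f n) := by
  induction M, h using Nat.le_induction with
  | base => simp
  | succ M h ih =>
    rw [Finset.sum_Ico_succ_top h, Finset.sum_Ico_succ_top h, ih]
    ring

/-- Partial sums of a `q`-periodic sequence with vanishing sum over the first period are
`q`-periodic. -/
lemma periodic_sum_range {E : Type*} [AddCommGroup E] {a : ℕ → E} {q : ℕ}
    (ha : Function.Periodic a q) (h0 : ∑ n ∈ Finset.range q, a n = 0) :
    Function.Periodic (fun n ↦ ∑ m ∈ Finset.range n, a m) q := by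
  intro n
  simp only
  rw [add_comm, Finset.sum_range_add, h0, zero_add]
  refine Finset.sum_congr rfl fun m _ ↦ ?_
  rw [add_comm]
  exact ha m

lemma norm_le_of_periodic {E : Type*} [NormedAddCommGroup E] {a : ℕ → E} {q : ℕ} (hq : 0 < q)
    (ha : Function.Periodic a q) {B : ℝ} (hB : ∀ n < q, ‖a n‖ ≤ B) (n : ℕ) : ‖a n‖ ≤ B := by
  rw [← ha.map_mod_nat n]
  exact hB _ (Nat.mod_lt _ hq)

/-- A second-order summation by parts bound for sums of a periodic sequence of mean zero against a
weight, in terms of the first and second differences of the weight. -/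
lemma norm_sum_Ico_mul_le_of_periodic {a : ℕ → ℂ} {q : ℕ} (hq : 0 < q)
    (ha : Function.Periodic a q) (h0 : ∑ n ∈ Finset.range q, a n = 0) {B : ℝ}
    (hB : ∀ n, ‖∑ m ∈ Finset.range n, a m‖ ≤ B) (f : ℕ → ℝ) {N M : ℕ} (h : N ≤ M) :
    ‖∑ n ∈ Finset.Ico N M, a n * (f n : ℂ)‖ ≤ 2 * B * (|f M| + |f N|) +
      2 * B * q * (|f (M + 1) - f M| + |f (N + 1) - f N| +
        ∑ n ∈ Finset.Ico N M, |f (n + 2) - f (n + 1) - (f (n + 1) - f n)|) := by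
  set T : ℕ → ℂ := fun n ↦ ∑ m ∈ Finset.range n, a m with hT
  have hTper : Function.Periodic T q := periodic_sum_range ha h0
  have hB0 : 0 ≤ B := (norm_nonneg _).trans (hB 0)
  have hqC : (q : ℂ) ≠ 0 := by exact_mod_cast hq.ne'
  have hqR : (0 : ℝ) < q := by exact_mod_cast hq
  set c : ℂ := (∑ n ∈ Finset.range q, T n) / q with hc
  have hcB : ‖c‖ ≤ B := by
    rw [hc, norm_div, Complex.norm_natCast, div_le_iff₀ hqR]
    calc ‖∑ n ∈ Finset.range q, T n‖ ≤ ∑ n ∈ Finset.range q, B :=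
          norm_sum_le_of_le _ fun n _ ↦ hB n
      _ = B * q := by simp [mul_comm]
  set V : ℕ → ℂ := fun n ↦ T n - c with hV
  have hVB (n : ℕ) : ‖V n‖ ≤ 2 * B := by
    calc ‖V n‖ ≤ ‖T n‖ + ‖c‖ := norm_sub_le _ _
      _ ≤ 2 * B := by linarith [hB n, hcB]
  have hVper : Function.Periodic V q := fun n ↦ by simp only [hV, hTper n]
  have hV0 : ∑ n ∈ Finset.range q, V n = 0 := by
    simp only [hV, Finset.sum_sub_distrib, hc]
    simp only [Finset.sum_const, Finset.card_range, nsmul_eq_mul]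
    field_simp
    simp
  set W : ℕ → ℂ := fun n ↦ ∑ m ∈ Finset.range n, V m with hW
  have hWB (n : ℕ) : ‖W n‖ ≤ 2 * B * q := by
    refine norm_le_of_periodic hq (periodic_sum_range hVper hV0) (fun n hn ↦ ?_) n
    calc ‖∑ m ∈ Finset.range n, V m‖ ≤ ∑ m ∈ Finset.range n, 2 * B :=
          norm_sum_le_of_le _ fun n _ ↦ hVB n
      _ = 2 * B * n := by simp [mul_comm]
      _ ≤ 2 * B * q := by gcongr
  have e1 : ∑ n ∈ Finset.Ico N M, a n * (f n : ℂ) =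
      ∑ n ∈ Finset.Ico N M, (V (n + 1) - V n) * (f n : ℂ) := by
    refine Finset.sum_congr rfl fun n _ ↦ ?_
    simp [hV, hT, Finset.sum_range_succ]
  have e2 : ∑ n ∈ Finset.Ico N M, V (n + 1) * ((f (n + 1) : ℂ) - f n) =
      ∑ n ∈ Finset.Ico N M, (W (n + 1 + 1) - W (n + 1)) * ((f (n + 1) : ℂ) - f n) := by
    refine Finset.sum_congr rfl fun n _ ↦ ?_
    simp [hW, Finset.sum_range_succ]
  rw [e1, sum_Ico_sub_mul_eq V (fun n ↦ (f n : ℂ)) h, e2,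
    sum_Ico_sub_mul_eq (fun n ↦ W (n + 1)) (fun n ↦ (f (n + 1) : ℂ) - f n) h]
  have n1 (n : ℕ) : ‖V n * (f n : ℂ)‖ ≤ 2 * B * |f n| := by
    rw [norm_mul, Complex.norm_real, Real.norm_eq_abs]
    gcongr
    exact hVB n
  have n2 (n : ℕ) : ‖W (n + 1) * ((f (n + 1) : ℂ) - f n)‖ ≤ 2 * B * q * |f (n + 1) - f n| := by
    rw [norm_mul, ← Complex.ofReal_sub, Complex.norm_real, Real.norm_eq_abs]
    gcongr
    exact hWB _
  have n3 : ‖∑ n ∈ Finset.Ico N M, W (n + 1 + 1) *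
        ((f (n + 1 + 1) : ℂ) - f (n + 1) - ((f (n + 1) : ℂ) - f n))‖ ≤
      2 * B * q * ∑ n ∈ Finset.Ico N M, |f (n + 2) - f (n + 1) - (f (n + 1) - f n)| := by
    rw [Finset.mul_sum]
    refine norm_sum_le_of_le _ fun n _ ↦ ?_
    rw [norm_mul, ← Complex.ofReal_sub, ← Complex.ofReal_sub, ← Complex.ofReal_sub,
      Complex.norm_real, Real.norm_eq_abs]
    gcongr
    exact hWB _
  grw [norm_sub_le, norm_sub_le, norm_sub_le, norm_sub_le, n1, n1, n2, n2, n3]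
  exact le_of_eq (by ring)

lemma sum_Ico_sub_add_two_le {H : ℕ → ℝ} {N M : ℕ} (h : N ≤ M) (hanti : H (N + 1) ≤ H N)
    (hpos : ∀ n, N ≤ n → 0 ≤ H n) :
    ∑ n ∈ Finset.Ico N M, (H n - H (n + 2)) ≤ 2 * H N := by
  have : ∑ n ∈ Finset.Ico N M, (H n - H (n + 2)) = H N + H (N + 1) - H M - H (M + 1) := by
    induction M, h using Nat.le_induction with
    | base => simp
    | succ M h ih => rw [Finset.sum_Ico_succ_top h, ih]; ring
  linarith [hpos M h, hpos (M + 1) (by omega)]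

/-- If the first two derivatives of `f` are dominated by `H` and `-H'` on `[x, ∞)`, then `H`
controls the first and second differences of `f`. -/
lemma abs_differences_le_of_hasDerivAt {f f₁ f₂ H H₁ : ℝ → ℝ} {x : ℝ}
    (hf : ∀ t, x ≤ t → HasDerivAt f (f₁ t) t) (hf₁ : ∀ t, x ≤ t → HasDerivAt f₁ (f₂ t) t)
    (hH : ∀ t, x ≤ t → HasDerivAt H (H₁ t) t) (h₁ : ∀ t, x ≤ t → |f₁ t| ≤ H t)
    (h₂ : ∀ t, x ≤ t → |f₂ t| ≤ -H₁ t) :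
    AntitoneOn H (Set.Ici x) ∧ (∀ t u, x ≤ t → t ≤ u → u ≤ t + 1 → |f u - f t| ≤ H t) ∧
      ∀ t, x ≤ t → |f (t + 2) - f (t + 1) - (f (t + 1) - f t)| ≤ H t - H (t + 2) := by
  have anti {g g₁ : ℝ → ℝ} (hg : ∀ t, x ≤ t → HasDerivAt g (g₁ t) t)
      (hle : ∀ t, x ≤ t → g₁ t ≤ 0) : AntitoneOn g (Set.Ici x) := by
    refine antitoneOn_of_deriv_nonpos (convex_Ici x)
      (fun t ht ↦ (hg t ht).continuousAt.continuousWithinAt) (fun t ht ↦ ?_) fun t ht ↦ ?_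
    · rw [interior_Ici] at ht
      exact (hg t (le_of_lt ht)).differentiableAt.differentiableWithinAt
    · rw [interior_Ici] at ht
      rw [(hg t (le_of_lt ht)).deriv]
      exact hle t (le_of_lt ht)
  have aH : AntitoneOn H (Set.Ici x) :=
    anti hH fun t ht ↦ by linarith [(abs_nonneg _).trans (h₂ t ht)]
  have aP : AntitoneOn (fun t ↦ H t + f₁ t) (Set.Ici x) :=
    anti (fun t ht ↦ (hH t ht).add (hf₁ t ht)) fun t ht ↦ by linarith [abs_le.mp (h₂ t ht)]
  have aM : AntitoneOn (fun t ↦ H t - f₁ t) (Set.Ici x) :=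
    anti (fun t ht ↦ (hH t ht).sub (hf₁ t ht)) fun t ht ↦ by linarith [abs_le.mp (h₂ t ht)]
  have mem {t : ℝ} (ht : x ≤ t) : t ∈ Set.Ici x := ht
  refine ⟨aH, fun t u ht htu hu ↦ ?_, fun t ht ↦ ?_⟩
  · rcases htu.eq_or_lt with rfl | htu
    · simpa using (abs_nonneg _).trans (h₁ t ht)
    obtain ⟨c, hc, hfc⟩ := exists_hasDerivAt_eq_slope f f₁ htu
      (fun s hs ↦ (hf s (ht.trans hs.1)).continuousAt.continuousWithinAt)
      (fun s hs ↦ hf s (ht.trans hs.1.le))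
    have hxc : x ≤ c := ht.trans hc.1.le
    have : f u - f t = f₁ c * (u - t) := by
      rw [hfc]; field_simp [(sub_pos.mpr htu).ne']
    rw [this, abs_mul, abs_of_pos (sub_pos.mpr htu)]
    calc |f₁ c| * (u - t) ≤ |f₁ c| * 1 := by gcongr; linarith
      _ ≤ H t := by rw [mul_one]; exact (h₁ c hxc).trans (aH (mem ht) (mem hxc) hc.1.le)
  · have hG (s : ℝ) (hs : x ≤ s) :
        HasDerivAt (fun t ↦ f (t + 1) - f t) (f₁ (s + 1) - f₁ s) s :=
      ((hf (s + 1) (by linarith)).comp_add_const s 1).sub (hf s hs)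
    obtain ⟨c, hc, hfc⟩ := exists_hasDerivAt_eq_slope (fun t ↦ f (t + 1) - f t)
      (fun s ↦ f₁ (s + 1) - f₁ s) (lt_add_one t)
      (fun s hs ↦ (hG s (ht.trans hs.1)).continuousAt.continuousWithinAt)
      (fun s hs ↦ hG s (ht.trans hs.1.le))
    have hxc : x ≤ c := ht.trans hc.1.le
    have e : f (t + 2) - f (t + 1) - (f (t + 1) - f t) = f₁ (c + 1) - f₁ c := by
      rw [hfc, show t + 1 + 1 = t + 2 by ring]; simp
    have i1 := aP (mem hxc) (mem (show x ≤ c + 1 by linarith)) (by linarith)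
    have i2 := aM (mem hxc) (mem (show x ≤ c + 1 by linarith)) (by linarith)
    have i3 := aH (mem ht) (mem hxc) hc.1.le
    have i4 := aH (mem (show x ≤ c + 1 by linarith)) (mem (show x ≤ t + 2 by linarith))
      (by linarith [hc.2])
    simp only at i1 i2
    rw [e, abs_le]
    constructor <;> linarith

lemma DirichletCharacter.IsPrimitive.ne_one {q : ℕ} [NeZero q] (hq : 2 ≤ q)
    {χ : DirichletCharacter ℂ q}
    (hχ : χ.IsPrimitive) : χ ≠ 1 := by
  rintro rfl
  rw [DirichletCharacter.isPrimitive_def, DirichletCharacter.conductor_one] at hχ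
  omega

lemma norm_natCast_cpow_sub_le {m n : ℕ} (hm : 0 < m) (hmn : m ≤ n) {s : ℂ} (hs : 0 ≤ s.re) :
    ‖(n : ℂ) ^ (-s) - (m : ℂ) ^ (-s)‖ ≤ ‖s‖ * (m : ℝ) ^ (-s.re - 1) * (n - m) := by
  rcases eq_or_ne s 0 with rfl | hs0
  · simp
  have hmR : (0 : ℝ) < m := by exact_mod_cast hm
  have hd (t : ℝ) (ht : t ∈ Set.Icc (m : ℝ) n) :
      HasDerivWithinAt (fun t : ℝ ↦ (t : ℂ) ^ (-s)) (-s * (t : ℂ) ^ (-s - 1)) (Set.Icc (m : ℝ) n)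
        t := by
    exact (hasDerivAt_ofReal_cpow_const (hmR.trans_le ht.1).ne'
      (neg_ne_zero.2 hs0)).hasDerivWithinAt
  have hb (t : ℝ) (ht : t ∈ Set.Icc (m : ℝ) n) :
      ‖-s * (t : ℂ) ^ (-s - 1)‖ ≤ ‖s‖ * (m : ℝ) ^ (-s.re - 1) := by
    rw [norm_mul, norm_neg, Complex.norm_cpow_eq_rpow_re_of_pos (hmR.trans_le ht.1)]
    gcongr
    simp only [sub_re, neg_re, one_re]
    exact Real.rpow_le_rpow_of_nonpos hmR ht.1 (by linarith)
  have hmn' : (m : ℝ) ≤ n := by exact_mod_cast hmn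
  have := (convex_Icc (m : ℝ) n).norm_image_sub_le_of_norm_hasDerivWithin_le hd hb
    (Set.left_mem_Icc.2 hmn') (Set.right_mem_Icc.2 hmn')
  simpa [abs_of_nonneg (sub_nonneg.2 hmn')] using this

/-- The block sums `∑_{kq < n ≤ (k+1)q} χ(n) n^{-s}` decay like `k ^ (-σ - 1)`, uniformly
for `s` in a half-plane intersected with a ball. -/
lemma norm_sum_dirichletCharacter_block_le {q : ℕ} [NeZero q] {χ : DirichletCharacter ℂ q}
    (hχ : χ ≠ 1) (k : ℕ) {s : ℂ} {σ R : ℝ} (hσ : 0 ≤ σ) (hs : σ ≤ s.re) (hR : ‖s‖ ≤ R) :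
    ‖∑ j ∈ Finset.range q, χ ((k * q + j + 1 : ℕ) : ZMod q) * ((k * q + j + 1 : ℕ) : ℂ) ^ (-s)‖ ≤
      q * (R * q) * ((k + 1 : ℕ) : ℝ) ^ (-σ - 1) := by
  have hq : 0 < q := Nat.pos_of_ne_zero (NeZero.ne q)
  have h0 : ∑ j ∈ Finset.range q, χ ((k * q + j + 1 : ℕ) : ZMod q) = 0 := by
    simp only [Nat.cast_add, Nat.cast_mul, CharP.cast_eq_zero, mul_zero, zero_add, Nat.cast_one]
    rw [← ZMod.sum_eq_sum_range (fun j : ZMod q ↦ χ (j + 1)),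
      Fintype.sum_equiv (Equiv.addRight (1 : ZMod q)) (fun j ↦ χ (j + 1)) χ fun _ ↦ rfl]
    exact MulChar.sum_eq_zero_of_ne_one hχ
  have h1 : ∑ j ∈ Finset.range q,
        χ ((k * q + j + 1 : ℕ) : ZMod q) * ((k * q + j + 1 : ℕ) : ℂ) ^ (-s) =
      ∑ j ∈ Finset.range q, χ ((k * q + j + 1 : ℕ) : ZMod q) *
        (((k * q + j + 1 : ℕ) : ℂ) ^ (-s) - ((k * q + 1 : ℕ) : ℂ) ^ (-s)) := by
    simp only [mul_sub, Finset.sum_sub_distrib]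
    rw [← Finset.sum_mul, h0, zero_mul, sub_zero]
  have hR0 : 0 ≤ R := (norm_nonneg _).trans hR
  rw [h1]
  calc _ ≤ ∑ j ∈ Finset.range q, R * q * ((k + 1 : ℕ) : ℝ) ^ (-σ - 1) := by
        refine norm_sum_le_of_le _ fun j hj ↦ ?_
        rw [norm_mul]
        refine (mul_le_of_le_one_left (norm_nonneg _) (χ.norm_le_one _)).trans ?_
        refine (norm_natCast_cpow_sub_le (by omega) (by omega) (hσ.trans hs)).trans ?_
        have hle : ((k * q + 1 : ℕ) : ℝ) ^ (-s.re - 1) ≤ ((k + 1 : ℕ) : ℝ) ^ (-σ - 1) := by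
          calc _ ≤ ((k * q + 1 : ℕ) : ℝ) ^ (-σ - 1) := by
                refine Real.rpow_le_rpow_of_exponent_le ?_ (by linarith)
                exact_mod_cast (by omega : 1 ≤ k * q + 1)
            _ ≤ _ := by
                refine Real.rpow_le_rpow_of_nonpos (by positivity) ?_ (by linarith)
                exact_mod_cast Nat.succ_le_succ (Nat.le_mul_of_pos_right k hq)
        have hj' : (j : ℝ) ≤ q := by exact_mod_cast (Finset.mem_range.1 hj).le
        have hj2 : ((k * q + j + 1 : ℕ) : ℝ) - ((k * q + 1 : ℕ) : ℝ) = j := by push_cast; ring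
        rw [hj2]
        calc _ ≤ R * ((k + 1 : ℕ) : ℝ) ^ (-σ - 1) * q := by gcongr
          _ = _ := by ring
    _ = _ := by simp [mul_assoc]

/-- Partial sums of `∑ χ(n) n^{-s}` along multiples of the modulus converge to `L(s, χ)` locally
uniformly near `s = 1`. -/
lemma tendstoLocallyUniformlyOn_sum_LFunction {q : ℕ} [NeZero q] {χ : DirichletCharacter ℂ q}
    (hχ : χ ≠ 1) :
    TendstoLocallyUniformlyOn
      (fun (K : ℕ) (s : ℂ) ↦
        ∑ n ∈ Finset.range (K * q), χ ((n + 1 : ℕ) : ZMod q) * ((n + 1 : ℕ) : ℂ) ^ (-s))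
      (DirichletCharacter.LFunction χ) atTop ({s : ℂ | 1 / 2 < s.re} ∩ Metric.ball 0 3) := by
  have hq : 0 < q := Nat.pos_of_ne_zero (NeZero.ne q)
  set U : Set ℂ := {s : ℂ | 1 / 2 < s.re} ∩ Metric.ball 0 3 with hU
  have hUo : IsOpen U := (isOpen_lt continuous_const continuous_re).inter Metric.isOpen_ball
  have hUc : Convex ℝ U := (convex_halfSpace_re_gt _).inter (convex_ball _ _)
  set b : ℕ → ℂ → ℂ := fun k s ↦ ∑ j ∈ Finset.range q,
    χ ((k * q + j + 1 : ℕ) : ZMod q) * ((k * q + j + 1 : ℕ) : ℂ) ^ (-s) with hb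
  have hbP (K : ℕ) (s : ℂ) : ∑ k ∈ Finset.range K, b k s =
      ∑ n ∈ Finset.range (K * q), χ ((n + 1 : ℕ) : ZMod q) * ((n + 1 : ℕ) : ℂ) ^ (-s) := by
    induction K with
    | zero => simp
    | succ K ih => rw [Finset.sum_range_succ, ih, Nat.succ_mul, Finset.sum_range_add]
  set u : ℕ → ℝ := fun k ↦ q * (3 * q) * ((k + 1 : ℕ) : ℝ) ^ (-(1 / 2 : ℝ) - 1) with hu
  have hus : Summable u := by
    refine Summable.mul_left _ ?_
    exact (summable_nat_add_iff 1).2 (Real.summable_nat_rpow.2 (by norm_num))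
  have hbu (k : ℕ) (s : ℂ) (hs : s ∈ U) : ‖b k s‖ ≤ u k :=
    norm_sum_dirichletCharacter_block_le hχ k (by norm_num) (le_of_lt hs.1)
      (mem_ball_zero_iff.1 hs.2).le
  have hbd (k : ℕ) : Differentiable ℂ (b k) := by
    refine Differentiable.fun_sum fun j _ ↦ ?_
    refine (Differentiable.const_cpow differentiable_neg (Or.inl ?_)).const_mul _
    exact Nat.cast_ne_zero.2 (Nat.succ_ne_zero (k * q + j))
  have hunif := (tendstoUniformlyOn_tsum_nat hus hbu).tendstoLocallyUniformlyOn
  have hdiff := differentiableOn_tsum_of_summable_norm hus (fun k ↦ (hbd k).differentiableOn)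
    hUo hbu
  have hright (s : ℂ) (hsU : s ∈ U) (hs : 1 < s.re) :
      ∑' k, b k s = DirichletCharacter.LFunction χ s := by
    have l1 : Tendsto (fun K ↦ ∑ k ∈ Finset.range K, b k s) atTop (𝓝 (∑' k, b k s)) :=
      (Summable.of_norm_bounded hus fun k ↦ hbu k s hsU).hasSum.tendsto_sum_nat
    have l2 := (χ.LSeriesSummable_of_one_lt_re hs).hasSum.tendsto_sum_nat
    have l3 : Tendsto (fun K : ℕ ↦ K * q + 1) atTop atTop :=
      tendsto_atTop_mono (fun K ↦ (Nat.le_mul_of_pos_right K hq).trans (Nat.le_succ _)) tendsto_id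
    have l4 := l2.comp l3
    rw [DirichletCharacter.LFunction_eq_LSeries χ hs]
    refine tendsto_nhds_unique l1 (l4.congr fun K ↦ ?_)
    rw [Function.comp_apply, hbP, Finset.sum_range_succ']
    simp only [LSeries.term_zero, add_zero]
    refine Finset.sum_congr rfl fun n _ ↦ ?_
    rw [LSeries.term_of_ne_zero (Nat.succ_ne_zero _), Complex.cpow_neg, div_eq_mul_inv]
  have heq : Set.EqOn (fun s ↦ ∑' k, b k s) (DirichletCharacter.LFunction χ) U := by
    have h2 : (2 : ℂ) ∈ U := by constructor <;> norm_num
    refine (hdiff.analyticOnNhd hUo).eqOn_of_preconnected_of_eventuallyEq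
      ((DirichletCharacter.differentiable_LFunction hχ).differentiableOn.analyticOnNhd hUo)
      hUc.isPreconnected h2 ?_
    filter_upwards [hUo.mem_nhds h2,
      (isOpen_lt continuous_const continuous_re).mem_nhds (show (1 : ℝ) < (2 : ℂ).re by norm_num)]
      with s h1 h2 using hright s h1 h2
  simpa only [hbP] using hunif.congr_right heq

/-- The `r`-th derivative of `L(s, χ)` at `s = 1` is the sum of the differentiated series, along
multiples of the modulus. -/
lemma tendsto_sum_iteratedDeriv_LFunction_one {q : ℕ} [NeZero q] {χ : DirichletCharacter ℂ q}
    (hχ : χ ≠ 1) (r : ℕ) :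
    Tendsto (fun K : ℕ ↦ (-1) ^ r * ∑ n ∈ Finset.Ico 1 (K * q + 1),
      χ (n : ZMod q) * (((Real.log n) ^ r / n : ℝ) : ℂ)) atTop
      (𝓝 (iteratedDeriv r (DirichletCharacter.LFunction χ) 1)) := by
  have hUo : IsOpen ({s : ℂ | 1 / 2 < s.re} ∩ Metric.ball 0 3) :=
    (isOpen_lt continuous_const continuous_re).inter Metric.isOpen_ball
  set D : ℕ → ℕ → ℂ → ℂ := fun r K s ↦ ∑ n ∈ Finset.range (K * q),
    χ ((n + 1 : ℕ) : ZMod q) * ((-Complex.log (n + 1 : ℕ)) ^ r * ((n + 1 : ℕ) : ℂ) ^ (-s)) with hD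
  have hderiv (r K : ℕ) (s : ℂ) : HasDerivAt (D r K) (D (r + 1) K s) s := by
    refine HasDerivAt.fun_sum fun n _ ↦ ?_
    have h0 : ((n + 1 : ℕ) : ℂ) ≠ 0 := by exact_mod_cast Nat.succ_ne_zero n
    have := (((hasDerivAt_neg s).const_cpow (c := ((n + 1 : ℕ) : ℂ)) (Or.inl h0)).const_mul
      ((-Complex.log (n + 1 : ℕ)) ^ r)).const_mul (χ ((n + 1 : ℕ) : ZMod q))
    refine this.congr_deriv ?_
    ring
  have key (r : ℕ) : TendstoLocallyUniformlyOn (D r)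
      (iteratedDeriv r (DirichletCharacter.LFunction χ)) atTop
      ({s : ℂ | 1 / 2 < s.re} ∩ Metric.ball 0 3) := by
    induction r with
    | zero => simpa [hD] using tendstoLocallyUniformlyOn_sum_LFunction hχ
    | succ r ih =>
      rw [iteratedDeriv_succ]
      refine (ih.deriv (Eventually.of_forall fun K s _ ↦
        (hderiv r K s).differentiableAt.differentiableWithinAt) hUo).congr fun K s _ ↦ ?_
      exact (hderiv r K s).deriv
  refine ((key r).tendsto_at (a := 1) (by constructor <;> norm_num)).congr fun K ↦ ?_
  simp only [hD]
  rw [Finset.range_eq_Ico, Finset.sum_Ico_add' (fun n : ℕ ↦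
    χ (n : ZMod q) * ((-Complex.log n) ^ r * (n : ℂ) ^ (-1 : ℂ))), zero_add, Finset.mul_sum]
  refine Finset.sum_congr rfl fun n _ ↦ ?_
  rw [← Complex.natCast_log, Complex.cpow_neg_one, neg_pow]
  push_cast
  ring

/-- Bounds for the differences of `(log t)^r / t` beyond the point `log t = r / 2 + ℓ`. -/
lemma abs_differences_log_pow_div_le {r : ℕ} (hr : 1 ≤ r) {ℓ x : ℝ} (hℓ : 1 ≤ ℓ) (hx : 0 < x)
    (hlog : ℓ + r / 2 ≤ Real.log x) :
    AntitoneOn (fun t ↦ 6 / ℓ * (Real.log t ^ (r + 1) / t ^ 2)) (Set.Ici x) ∧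
      (∀ t u, x ≤ t → t ≤ u → u ≤ t + 1 →
        |Real.log u ^ r / u - Real.log t ^ r / t| ≤ 6 / ℓ * (Real.log t ^ (r + 1) / t ^ 2)) ∧
      ∀ t, x ≤ t → |Real.log (t + 2) ^ r / (t + 2) - Real.log (t + 1) ^ r / (t + 1) -
          (Real.log (t + 1) ^ r / (t + 1) - Real.log t ^ r / t)| ≤
        6 / ℓ * (Real.log t ^ (r + 1) / t ^ 2) -
          6 / ℓ * (Real.log (t + 2) ^ (r + 1) / (t + 2) ^ 2) := by
  have hℓ0 : 0 < ℓ := by linarith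
  have hu {t : ℝ} (ht : x ≤ t) : ℓ + r / 2 ≤ Real.log t :=
    hlog.trans (Real.log_le_log hx ht)
  have hr0 : (0 : ℝ) ≤ r := Nat.cast_nonneg r
  obtain ⟨m, rfl⟩ : ∃ m, r = m + 1 := ⟨r - 1, by omega⟩
  have hmul {t : ℝ} (ht : x ≤ t) : ((m + 1 : ℕ) : ℝ) * Real.log t ^ m ≤
      2 * Real.log t ^ (m + 1) := by
    have := hu ht
    have h0 : 0 ≤ Real.log t := by linarith
    rw [pow_succ]
    nlinarith [pow_nonneg h0 m]
  refine abs_differences_le_of_hasDerivAt (f := fun t ↦ Real.log t ^ (m + 1) / t)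
    (f₁ := fun t ↦ (((m + 1 : ℕ) : ℝ) * Real.log t ^ m - Real.log t ^ (m + 1)) / t ^ 2)
    (f₂ := fun t ↦ (((m + 1 : ℕ) : ℝ) * (m * Real.log t ^ (m - 1)) -
      3 * (((m + 1 : ℕ) : ℝ) * Real.log t ^ m) + 2 * Real.log t ^ (m + 1)) / t ^ 3)
    (H := fun t ↦ 6 / ℓ * (Real.log t ^ (m + 1 + 1) / t ^ 2))
    (H₁ := fun t ↦ 6 / ℓ * ((((m + 1 + 1 : ℕ) : ℝ) * Real.log t ^ (m + 1) -
      2 * Real.log t ^ (m + 1 + 1)) / t ^ 3))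
    (fun t ht ↦ ?_) (fun t ht ↦ ?_) (fun t ht ↦ ?_) (fun t ht ↦ ?_) (fun t ht ↦ ?_)
  · have h0 : t ≠ 0 := (hx.trans_le ht).ne'
    refine (((Real.hasDerivAt_log h0).pow (m + 1)).div (hasDerivAt_id t) h0).congr_deriv ?_
    simp only [id, Nat.add_sub_cancel, Pi.pow_apply]
    field_simp
  · have h0 : t ≠ 0 := (hx.trans_le ht).ne'
    refine (((((Real.hasDerivAt_log h0).pow m).const_mul ((m + 1 : ℕ) : ℝ)).sub
      ((Real.hasDerivAt_log h0).pow (m + 1))).div (hasDerivAt_pow 2 t)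
        (pow_ne_zero 2 h0)).congr_deriv ?_
    simp only [Nat.add_sub_cancel, Pi.pow_apply, Pi.sub_apply]
    field_simp
    push_cast
    ring
  · have h0 : t ≠ 0 := (hx.trans_le ht).ne'
    refine ((((Real.hasDerivAt_log h0).pow (m + 1 + 1)).div (hasDerivAt_pow 2 t)
        (pow_ne_zero 2 h0)).const_mul (6 / ℓ)).congr_deriv ?_
    simp only [Nat.add_sub_cancel, Pi.pow_apply]
    field_simp
    push_cast
    ring
  · have ht0 := hx.trans_le ht
    have hlt := hu ht
    have h0 : 0 < Real.log t := by linarith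
    have hp : 0 < Real.log t ^ (m + 1) := by positivity
    have hb0 : 0 ≤ ((m + 1 : ℕ) : ℝ) * Real.log t ^ m := by positivity
    rw [abs_div, abs_of_pos (pow_pos ht0 2), ← mul_div_assoc]
    gcongr
    have h1 : |((m + 1 : ℕ) : ℝ) * Real.log t ^ m - Real.log t ^ (m + 1)| ≤
        Real.log t ^ (m + 1) := by
      rw [abs_le]; constructor <;> linarith [hmul ht]
    refine h1.trans ?_
    rw [pow_succ _ (m + 1), div_mul_eq_mul_div, le_div_iff₀ hℓ0]
    nlinarith [mul_le_mul_of_nonneg_left (show ℓ ≤ Real.log t by linarith) hp.le]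
  · have ht0 := hx.trans_le ht
    have hlt := hu ht
    have h0 : 0 < Real.log t := by linarith
    have hp : 0 < Real.log t ^ (m + 1) := by positivity
    have hb0 : 0 ≤ ((m + 1 : ℕ) : ℝ) * Real.log t ^ m := by positivity
    have ha0 : 0 ≤ ((m + 1 : ℕ) : ℝ) * (m * Real.log t ^ (m - 1)) := by positivity
    have ha : (m : ℝ) * Real.log t ^ (m - 1) ≤ 2 * Real.log t ^ m := by
      rcases m with _ | m
      · simp
      · rw [Nat.add_sub_cancel, pow_succ]
        push_cast at hlt ⊢
        nlinarith [pow_pos h0 m]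
    have ha' : ((m + 1 : ℕ) : ℝ) * (m * Real.log t ^ (m - 1)) ≤ 4 * Real.log t ^ (m + 1) := by
      have := mul_le_mul_of_nonneg_left ha hr0
      linarith [hmul ht]
    rw [abs_div, abs_of_pos (pow_pos ht0 3), ← mul_div_assoc, ← neg_div]
    gcongr
    have h1 : |((m + 1 : ℕ) : ℝ) * (m * Real.log t ^ (m - 1)) -
        3 * (((m + 1 : ℕ) : ℝ) * Real.log t ^ m) + 2 * Real.log t ^ (m + 1)| ≤
        6 * Real.log t ^ (m + 1) := by
      rw [abs_le]; constructor <;> linarith [hmul ht]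
    refine h1.trans ?_
    have h2 : ℓ ≤ 2 * Real.log t - ((m + 1 + 1 : ℕ) : ℝ) := by
      push_cast at hlt ⊢; linarith
    calc 6 * Real.log t ^ (m + 1) = 6 / ℓ * (Real.log t ^ (m + 1) * ℓ) := by field_simp
      _ ≤ 6 / ℓ * (Real.log t ^ (m + 1) * (2 * Real.log t - ((m + 1 + 1 : ℕ) : ℝ))) := by gcongr
      _ = _ := by ring

/-- Truncation of the series for `L^{(r)}(1, χ)` at any point `x` with `log x ≥ r / 2 + 1`. -/
lemma norm_iteratedDeriv_LFunction_one_sub_le {q : ℕ} [NeZero q] {χ : DirichletCharacter ℂ q}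
    (hχ : χ ≠ 1) {B : ℝ} (hB : ∀ n, ‖∑ m ∈ Finset.range n, χ (m : ZMod q)‖ ≤ B) {r : ℕ}
    (hr : 1 ≤ r) {ℓ x : ℝ} (hℓ : 1 ≤ ℓ) (hx : 0 < x) (hlog : ℓ + r / 2 ≤ Real.log x) :
    ‖iteratedDeriv r (DirichletCharacter.LFunction χ) 1 - (-1) ^ r * ∑ n ∈ Finset.Icc 1 ⌊x⌋₊,
        χ (n : ZMod q) * (Real.log n : ℂ) ^ r / (n : ℂ)‖ ≤
      2 * B * (Real.log x ^ r / x) + 10 * B * q * (6 / ℓ * (Real.log x ^ (r + 1) / x ^ 2)) := by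
  obtain ⟨hanti, hdiff, hdiff2⟩ := abs_differences_log_pow_div_le hr hℓ hx hlog
  set f : ℝ → ℝ := fun t ↦ Real.log t ^ r / t with hf
  set H : ℝ → ℝ := fun t ↦ 6 / ℓ * (Real.log t ^ (r + 1) / t ^ 2) with hH
  have hB0 : 0 ≤ B := (norm_nonneg _).trans (hB 0)
  have hq : 0 < q := Nat.pos_of_ne_zero (NeZero.ne q)
  have hq1 : (1 : ℝ) ≤ q := by exact_mod_cast hq
  have hr0 : (0 : ℝ) ≤ r := Nat.cast_nonneg r
  have hlogpos {t : ℝ} (ht : x ≤ t) : 0 ≤ Real.log t := by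
    linarith [Real.log_le_log hx ht]
  have hfpos {t : ℝ} (ht : x ≤ t) : 0 ≤ f t :=
    div_nonneg (pow_nonneg (hlogpos ht) _) (hx.le.trans ht)
  have hHpos {t : ℝ} (ht : x ≤ t) : 0 ≤ H t :=
    mul_nonneg (by positivity) (div_nonneg (pow_nonneg (hlogpos ht) _) (sq_nonneg t))
  set N := ⌊x⌋₊ + 1 with hN
  have hxN : x ≤ (N : ℝ) := by rw [hN]; push_cast; exact (Nat.lt_floor_add_one x).le
  have hNx : (N : ℝ) ≤ x + 1 := by
    rw [hN]; push_cast; linarith [Nat.floor_le hx.le]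
  have hxn {n : ℕ} (hn : N ≤ n) : x ≤ (n : ℝ) := hxN.trans (by exact_mod_cast hn)
  have hHle {n : ℕ} (hn : N ≤ n) : H n ≤ H x :=
    hanti (Set.self_mem_Ici) (hxn hn) (hxn hn)
  have hfN : f N ≤ f x + H x := by
    linarith [(abs_le.1 (hdiff x N le_rfl hxN hNx)).2]
  have hper : Function.Periodic (fun n : ℕ ↦ χ (n : ZMod q)) q := fun n ↦ by simp
  have hzero : ∑ n ∈ Finset.range q, χ (n : ZMod q) = 0 := by
    rw [← ZMod.sum_eq_sum_range (fun j : ZMod q ↦ χ j)]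
    exact MulChar.sum_eq_zero_of_ne_one hχ
  have hfinite {M : ℕ} (hM : N ≤ M) :
      ‖∑ n ∈ Finset.Ico N M, χ (n : ZMod q) * ((f n : ℝ) : ℂ)‖ ≤
        2 * B * f x + 10 * B * q * H x + 2 * B * f M := by
    refine (norm_sum_Ico_mul_le_of_periodic hq hper hzero hB (fun n ↦ f n) hM).trans ?_
    have hstep {n : ℕ} (hn : N ≤ n) : |f (n + 1 : ℕ) - f n| ≤ H x := by
      push_cast
      exact (hdiff n (n + 1) (hxn hn) (by linarith) le_rfl).trans (hHle hn)
    have hsum : ∑ n ∈ Finset.Ico N M,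
        |f (n + 2 : ℕ) - f (n + 1 : ℕ) - (f (n + 1 : ℕ) - f n)| ≤ 2 * H x := by
      calc _ ≤ ∑ n ∈ Finset.Ico N M, (H n - H (n + 2 : ℕ)) := by
            refine Finset.sum_le_sum fun n hn ↦ ?_
            push_cast
            exact hdiff2 n (hxn (Finset.mem_Ico.1 hn).1)
        _ ≤ 2 * H N := sum_Ico_sub_add_two_le (H := fun n ↦ H n) hM
            (hanti (hxn le_rfl) (hxn (Nat.le_succ N)) (by push_cast; linarith))
            fun n hn ↦ hHpos (hxn hn)
        _ ≤ 2 * H x := by linarith [hHle le_rfl]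
    rw [abs_of_nonneg (hfpos (hxn hM)), abs_of_nonneg (hfpos hxN)]
    have h1 : |f (M + 1 : ℕ) - f M| + |f (N + 1 : ℕ) - f N| + ∑ n ∈ Finset.Ico N M,
        |f (n + 2 : ℕ) - f (n + 1 : ℕ) - (f (n + 1 : ℕ) - f n)| ≤ 4 * H x := by
      linarith [hstep hM, hstep le_rfl]
    have h2 : 2 * B * q * (|f (M + 1 : ℕ) - f M| + |f (N + 1 : ℕ) - f N| +
        ∑ n ∈ Finset.Ico N M, |f (n + 2 : ℕ) - f (n + 1 : ℕ) - (f (n + 1 : ℕ) - f n)|) ≤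
        2 * B * q * (4 * H x) := by gcongr
    have h3 : 2 * B * (f M + f N) ≤ 2 * B * (f M + (f x + H x)) := by gcongr
    have h4 : B * H x * 1 ≤ B * H x * q :=
      mul_le_mul_of_nonneg_left hq1 (mul_nonneg hB0 (hHpos le_rfl))
    linarith
  have hM : Tendsto (fun K : ℕ ↦ K * q + 1) atTop atTop :=
    tendsto_atTop_mono (fun K ↦ (Nat.le_mul_of_pos_right K hq).trans (Nat.le_succ _)) tendsto_id
  have hf0 : Tendsto (fun K : ℕ ↦ f (K * q + 1 : ℕ)) atTop (𝓝 0) :=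
    (Real.isLittleO_pow_log_id_atTop (n := r)).tendsto_div_nhds_zero.comp
      (tendsto_natCast_atTop_atTop.comp hM)
  refine le_of_tendsto_of_tendsto
    (((tendsto_sum_iteratedDeriv_LFunction_one hχ r).sub_const _).norm)
    (by simpa only [mul_zero, add_zero] using
      (hf0.const_mul (2 * B)).const_add (2 * B * f x + 10 * B * q * H x)) ?_
  filter_upwards [hM.eventually_ge_atTop N] with K hK
  refine le_of_eq_of_le ?_ (hfinite hK)
  rw [← mul_sub, norm_mul, norm_pow, norm_neg, norm_one, one_pow, one_mul,
    ← Finset.sum_Ico_consecutive _ (show 1 ≤ N by omega) hK]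
  congr 1
  rw [sub_eq_iff_eq_add, add_comm]
  congr 1
  refine Finset.sum_congr (by ext n; simp only [Finset.mem_Ico, Finset.mem_Icc]; omega)
    fun n _ ↦ ?_
  push_cast
  ring

lemma norm_sum_dirichletCharacter_log_pow_div_le {q : ℕ} (χ : DirichletCharacter ℂ q) (r : ℕ)
    {x : ℝ} (hx : 1 ≤ x) :
    ‖∑ n ∈ Finset.Icc 1 ⌊x⌋₊, χ (n : ZMod q) * (Real.log n : ℂ) ^ r / (n : ℂ)‖ ≤
      Real.log x ^ r * (1 + Real.log x) := by
  have hlx : 0 ≤ Real.log x := Real.log_nonneg hx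
  calc _ ≤ ∑ n ∈ Finset.Icc 1 ⌊x⌋₊, Real.log x ^ r * (n : ℝ)⁻¹ := by
        refine norm_sum_le_of_le _ fun n hn ↦ ?_
        obtain ⟨h1, h2⟩ := Finset.mem_Icc.1 hn
        have h1' : (1 : ℝ) ≤ n := by exact_mod_cast h1
        have hnx : (n : ℝ) ≤ x := (Nat.le_floor_iff (by linarith)).1 h2
        have hln : 0 ≤ Real.log n := Real.log_nonneg h1'
        rw [norm_div, norm_mul, norm_pow, Complex.norm_natCast, Complex.norm_real,
          Real.norm_of_nonneg hln, div_eq_mul_inv]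
        gcongr
        exact (mul_le_of_le_one_left (by positivity) (χ.norm_le_one _)).trans (by gcongr)
    _ = Real.log x ^ r * ((harmonic ⌊x⌋₊ : ℚ) : ℝ) := by
        rw [← Finset.mul_sum, harmonic_eq_sum_Icc]
        push_cast
        rfl
    _ ≤ _ := by
        gcongr
        exact harmonic_floor_le_one_add_log x hx

/-- there is an absolute constant such that for every primitive Dirichlet
character `χ` mod `q ≥ 3` and every `r ≥ 1`,
`L^{(r)}(1,χ) = (-1)^r ∑_{n ≤ q·e^{r/2}} χ(n)(log n)^r/n
  + O(q^{-1/2} e^{-r/2} log q (log q + r/2)^r)` and `|L^{(r)}(1,χ)| ≪ (log q + r/2)^{r+1}`. -/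
theorem stmt13 : ∃ C : ℝ, 0 < C ∧ ∀ (q : ℕ) [NeZero q], 3 ≤ q →
    ∀ (χ : DirichletCharacter ℂ q), χ.IsPrimitive → ∀ r : ℕ, 1 ≤ r →
    ‖iteratedDeriv r (DirichletCharacter.LFunction χ) 1
        - (-1) ^ r * ∑ n ∈ Finset.Icc 1 ⌊(q : ℝ) * Real.exp (r / 2)⌋₊,
            χ (n : ZMod q) * (Real.log n : ℂ) ^ r / (n : ℂ)‖ ≤
      C * (q : ℝ) ^ (-(1 : ℝ) / 2) * Real.exp (-(r : ℝ) / 2) * Real.log q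
        * (Real.log q + r / 2) ^ r ∧
    ‖iteratedDeriv r (DirichletCharacter.LFunction χ) 1‖ ≤
      C * (Real.log q + r / 2) ^ (r + 1) := by
  refine ⟨126, by norm_num, fun q _ hq χ hχ r hr ↦ ?_⟩
  have hqR : (3 : ℝ) ≤ q := by exact_mod_cast hq
  have hq0 : (0 : ℝ) < q := by linarith
  have hL : 1 ≤ Real.log q := by
    rw [Real.le_log_iff_exp_le hq0]
    linarith [Real.exp_one_lt_d9]
  have hL0 : 0 < Real.log q := by linarith
  have hr0 : (0 : ℝ) ≤ r := Nat.cast_nonneg r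
  set E := Real.exp (r / 2 : ℝ) with hE
  have hE1 : 1 + (r : ℝ) / 2 ≤ E := by linarith [Real.add_one_le_exp (r / 2 : ℝ)]
  have hE0 : 0 < E := Real.exp_pos _
  have hx1 : 1 ≤ q * E := by nlinarith
  have hlog : Real.log (q * E) = Real.log q + r / 2 := by
    rw [Real.log_mul hq0.ne' hE0.ne', hE, Real.log_exp]
  set U := Real.log q + r / 2 with hU
  have hU1 : 1 ≤ U := by rw [hU]; linarith [div_nonneg hr0 zero_le_two]
  have hUE : U ≤ Real.log q * E := by
    rw [hU]; nlinarith
  have hmain := norm_iteratedDeriv_LFunction_one_sub_le (hχ.ne_one (by omega))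
    (hχ.norm_sum_range_le hq) hr hL (by linarith) hlog.ge
  have hsqrt : √(q : ℝ) = q * (q : ℝ) ^ (-(1 : ℝ) / 2) := by
    rw [Real.sqrt_eq_rpow, ← Real.rpow_one_add' hq0.le (by norm_num)]
    norm_num
  have hexp : Real.exp (-(r : ℝ) / 2) = E⁻¹ := by rw [hE, ← Real.exp_neg, neg_div]
  set Q := (q : ℝ) ^ (-(1 : ℝ) / 2) with hQ
  have hQ0 : 0 < Q := Real.rpow_pos_of_pos hq0 _
  have hQ1 : Q ≤ 1 := Real.rpow_le_one_of_one_le_of_nonpos (by linarith) (by norm_num)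
  have herr : ‖iteratedDeriv r (DirichletCharacter.LFunction χ) 1
        - (-1) ^ r * ∑ n ∈ Finset.Icc 1 ⌊(q : ℝ) * E⌋₊,
            χ (n : ZMod q) * (Real.log n : ℂ) ^ r / (n : ℂ)‖ ≤
      124 * Q * Real.exp (-(r : ℝ) / 2) * Real.log q * U ^ r := by
    refine hmain.trans ?_
    rw [hlog, hsqrt, hexp]
    have h1 : 10 * (2 * (q * Q) * Real.log q) * q *
        (6 / Real.log q * (U ^ (r + 1) / (q * E) ^ 2)) =
        120 * Q * E⁻¹ * U ^ r * (U / E) := by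
      field_simp
      ring
    have h2 : 2 * (2 * (q * Q) * Real.log q) * (U ^ r / (q * E)) =
        4 * Q * E⁻¹ * Real.log q * U ^ r := by
      field_simp
      ring
    have h3 : 120 * Q * E⁻¹ * U ^ r * (U / E) ≤ 120 * Q * E⁻¹ * U ^ r * Real.log q := by
      gcongr
      exact (div_le_iff₀ hE0).2 hUE
    rw [h1, h2]
    linarith
  have hLU : Real.log q ≤ U := by rw [hU]; linarith [div_nonneg hr0 zero_le_two]
  constructor
  · refine herr.trans ?_
    gcongr
    norm_num
  · have hsum := norm_sum_dirichletCharacter_log_pow_div_le χ r hx1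
    rw [hlog] at hsum
    have herr' : 124 * Q * Real.exp (-(r : ℝ) / 2) * Real.log q * U ^ r ≤ 124 * U ^ (r + 1) := by
      have : Real.exp (-(r : ℝ) / 2) ≤ 1 := Real.exp_le_one_iff.2 (by linarith)
      calc _ ≤ 124 * 1 * 1 * U * U ^ r := by gcongr
        _ = _ := by ring
    have hsum' : U ^ r * (1 + U) ≤ 2 * U ^ (r + 1) := by
      rw [pow_succ]; nlinarith [pow_pos (show 0 < U by linarith) r]
    have htri := norm_le_norm_sub_add (iteratedDeriv r (DirichletCharacter.LFunction χ) 1)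
      ((-1) ^ r * ∑ n ∈ Finset.Icc 1 ⌊(q : ℝ) * E⌋₊,
            χ (n : ZMod q) * (Real.log n : ℂ) ^ r / (n : ℂ))
    rw [norm_mul ((-1 : ℂ) ^ r), norm_pow, norm_neg, norm_one, one_pow, one_mul] at htri
    linarith
end
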